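/- arXiv:2403.06560 — 9 statements merged into one kernel-verified Lean document; each statement's English description precedes it below -/
import Mathlib

section
/- Let M and N be Polish spaces, let f : M → N be a Borel measurable map, and let μ, ν be Borel probability measures on M. Then the set of couplings of the pushforward measures f_#μ and f_#ν equals the set of pushforwards of couplings of μ and ν under f ⊗ f, i.e. Π(f_#μ, f_#ν) = {(f ⊗ f)_#γ : γ ∈ Π(μ, ν)}, where (f ⊗ f)(x,y) = (f(x), f(y)). -/
open MeasureTheory

open ProbabilityTheory

namespace MeasureTheory.Measure

variable {α β γ δ : Type*} {mα : MeasurableSpace α} {mβ : MeasurableSpace β}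
  {mγ : MeasurableSpace γ} {mδ : MeasurableSpace δ}

/-- Composing a kernel with an image measure amounts to composing its comap with the measure. -/
lemma comp_map_eq_comap_comp (μ : Measure α) (κ : Kernel β γ) {f : α → β} (hf : Measurable f) :
    κ ∘ₘ μ.map f = κ.comap f hf ∘ₘ μ := by
  rw [← deterministic_comp_eq_map hf, comp_assoc, Kernel.comp_deterministic_eq_comap]

lemma map_fst_parallelComp_comp (ρ : Measure (α × γ)) (κ : Kernel α β) (η : Kernel γ δ)
    [IsSFiniteKernel κ] [IsMarkovKernel η] :
    ((κ ∥ₖ η) ∘ₘ ρ).map Prod.fst = κ ∘ₘ ρ.map Prod.fst := by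
  rw [map_comp _ _ measurable_fst, comp_map_eq_comap_comp _ _ measurable_fst]
  congr 2
  ext x : 1
  rw [Kernel.map_apply _ measurable_fst, Kernel.parallelComp_apply, Kernel.comap_apply,
    map_fst_prod, measure_univ, one_smul]

lemma map_snd_parallelComp_comp (ρ : Measure (α × γ)) (κ : Kernel α β) (η : Kernel γ δ)
    [IsMarkovKernel κ] [IsSFiniteKernel η] :
    ((κ ∥ₖ η) ∘ₘ ρ).map Prod.snd = η ∘ₘ ρ.map Prod.snd := by
  rw [map_comp _ _ measurable_snd, comp_map_eq_comap_comp _ _ measurable_snd]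
  congr 2
  ext x : 1
  rw [Kernel.map_apply _ measurable_snd, Kernel.parallelComp_apply, Kernel.comap_apply,
    map_snd_prod, measure_univ, one_smul]

end MeasureTheory.Measure

namespace ProbabilityTheory

variable {α β : Type*} {mα : MeasurableSpace α} {mβ : MeasurableSpace β}
  [StandardBorelSpace α] [Nonempty α] [StandardBorelSpace β]

/-- The disintegration of `μ` along `f` is almost surely supported on the fibres of `f`. -/
lemma condDistrib_id_map_ae_eq_dirac (μ : Measure α) [IsFiniteMeasure μ]
    {f : α → β} (hf : Measurable f) :
    ∀ᵐ x ∂μ.map f, (condDistrib id f μ x).map f = Measure.dirac x := by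
  have : Nonempty β := .map f ‹_›
  filter_upwards [condDistrib_comp (μ := μ) (Y := id) f aemeasurable_id hf,
    condDistrib_self (μ := μ) f] with x hx hx'
  rw [← Kernel.map_apply _ hf, ← hx, Function.comp_id, hx', Kernel.id_apply]

end ProbabilityTheory

/-- Let `M` and `N` be Polish spaces, `f : M → N` a Borel measurable map, and
`μ, ν` Borel probability measures on `M`. Then the set of couplings of the pushforwards `f_#μ`
and `f_#ν` is exactly the set of pushforwards under `f ⊗ f` of couplings of `μ` and `ν`. -/
theorem couplings_map_eq_image_map_couplings
    {M N : Type*} [MetricSpace M] [CompleteSpace M] [TopologicalSpace.SeparableSpace M]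
    [MeasurableSpace M] [BorelSpace M]
    [MetricSpace N] [CompleteSpace N] [TopologicalSpace.SeparableSpace N]
    [MeasurableSpace N] [BorelSpace N]
    (f : M → N) (hf : Measurable f)
    (μ ν : Measure M) [IsProbabilityMeasure μ] [IsProbabilityMeasure ν] :
    {γ : Measure (N × N) | γ.map Prod.fst = μ.map f ∧ γ.map Prod.snd = ν.map f} =
      (fun γ : Measure (M × M) => γ.map (fun z : M × M => (f z.1, f z.2))) ''
        {γ : Measure (M × M) | γ.map Prod.fst = μ ∧ γ.map Prod.snd = ν} := by
  have : SecondCountableTopology M := UniformSpace.secondCountable_of_separable M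
  have : SecondCountableTopology N := UniformSpace.secondCountable_of_separable N
  have hff : Measurable fun z : M × M => (f z.1, f z.2) := by fun_prop
  ext γ
  constructor
  · rintro ⟨hγ₁, hγ₂⟩
    have : Nonempty M := nonempty_of_isProbabilityMeasure μ
    refine ⟨(condDistrib id f μ ∥ₖ condDistrib id f ν) ∘ₘ γ, ⟨?_, ?_⟩, ?_⟩
    · rw [Measure.map_fst_parallelComp_comp, hγ₁,
        condDistrib_comp_map hf.aemeasurable aemeasurable_id, Measure.map_id]
    · rw [Measure.map_snd_parallelComp_comp, hγ₂,
        condDistrib_comp_map hf.aemeasurable aemeasurable_id, Measure.map_id]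
    · have h₁ := condDistrib_id_map_ae_eq_dirac μ hf
      have h₂ := condDistrib_id_map_ae_eq_dirac ν hf
      rw [← hγ₁] at h₁
      rw [← hγ₂] at h₂
      beta_reduce
      rw [Measure.map_comp _ _ hff]
      refine (Measure.comp_congr (η := Kernel.id) ?_).trans Measure.id_comp
      filter_upwards [ae_of_ae_map measurable_fst.aemeasurable h₁,
        ae_of_ae_map measurable_snd.aemeasurable h₂] with z hz₁ hz₂
      rw [Kernel.map_apply _ hff, Kernel.parallelComp_apply, Kernel.id_apply]
      change Measure.map (Prod.map f f) _ = _
      rw [← Measure.map_prod_map _ _ hf hf, hz₁, hz₂, Measure.dirac_prod_dirac]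
  · rintro ⟨ρ, ⟨rfl, rfl⟩, rfl⟩
    constructor
    · rw [Measure.map_map measurable_fst hff, Measure.map_map hf measurable_fst]
      rfl
    · rw [Measure.map_map measurable_snd hff, Measure.map_map hf measurable_snd]
      rfl
end

section
/- In the sliced setting, for every p ≥ 1, CHSW_p is a finite pseudo-distance on 𝒫_p(E): for all μ, ν, α ∈ 𝒫_p(E), CHSW_p(μ,ν) < ∞, CHSW_p(μ,ν) ≥ 0, CHSW_p(μ,μ) = 0, CHSW_p(μ,ν) = CHSW_p(ν,μ), and CHSW_p(μ,ν) ≤ CHSW_p(μ,α) + CHSW_p(α,ν). -/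
open MeasureTheory ENNReal

/-- The infimal transport cost between `μ` and `ν` for an `ℝ≥0∞`-valued cost `c`. -/
noncomputable def transportCost {X : Type*} [MeasurableSpace X]
    (c : X → X → ℝ≥0∞) (μ ν : Measure X) : ℝ≥0∞ :=
  ⨅ γ ∈ {γ : Measure (X × X) | γ.map Prod.fst = μ ∧ γ.map Prod.snd = ν},
    ∫⁻ z, c z.1 z.2 ∂γ

/-- `W_p^p` on the real line, with ground distance `|s - t|`. -/
noncomputable def wpPowReal (p : ℝ) (μ ν : Measure ℝ) : ℝ≥0∞ :=
  transportCost (fun s t => ENNReal.ofReal (|s - t| ^ p)) μ ν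

/-- `CHSW_p^p(μ, ν) = ∫ W_p^p(P^v_#μ, P^v_#ν) dλ(v)`. -/
noncomputable def chswPow {E V : Type*} [MeasurableSpace E] [MeasurableSpace V]
    (P : V → E → ℝ) (lam : Measure V) (p : ℝ) (μ ν : Measure E) : ℝ≥0∞ :=
  ∫⁻ v, wpPowReal p (μ.map (P v)) (ν.map (P v)) ∂lam

/-- `CHSW_p = (CHSW_p^p)^{1/p}`. -/
noncomputable def chsw {E V : Type*} [MeasurableSpace E] [MeasurableSpace V]
    (P : V → E → ℝ) (lam : Measure V) (p : ℝ) (μ ν : Measure E) : ℝ≥0∞ :=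
  (chswPow P lam p μ ν) ^ (1 / p)

open ProbabilityTheory

/-- The Wasserstein distance `W_p` on the real line. -/
noncomputable def wpReal (p : ℝ) (μ ν : Measure ℝ) : ℝ≥0∞ :=
  wpPowReal p μ ν ^ (1 / p)

lemma ofReal_abs_sub_rpow {p : ℝ} (hp : 0 ≤ p) (s t : ℝ) :
    ENNReal.ofReal (|s - t| ^ p) = edist s t ^ p := by
  rw [← ENNReal.ofReal_rpow_of_nonneg (abs_nonneg _) hp, edist_dist, Real.dist_eq]

lemma wpPowReal_eq {p : ℝ} (hp : 0 ≤ p) (μ ν : Measure ℝ) :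
    wpPowReal p μ ν =
      ⨅ γ ∈ {γ : Measure (ℝ × ℝ) | γ.map Prod.fst = μ ∧ γ.map Prod.snd = ν},
        ∫⁻ z, edist z.1 z.2 ^ p ∂γ := by
  simp only [wpPowReal, transportCost, ofReal_abs_sub_rpow hp]

lemma wpReal_eq {p : ℝ} (hp : 0 < p) (μ ν : Measure ℝ) :
    wpReal p μ ν =
      ⨅ γ ∈ {γ : Measure (ℝ × ℝ) | γ.map Prod.fst = μ ∧ γ.map Prod.snd = ν},
        (∫⁻ z, edist z.1 z.2 ^ p ∂γ) ^ (1 / p) := by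
  rw [wpReal, wpPowReal_eq hp.le]
  have h := one_div_pos.mpr hp
  exact ((orderIsoRpow (1 / p) h).map_iInf _).trans
    (iInf_congr fun γ => (orderIsoRpow (1 / p) h).map_iInf _)

/-- The cost of the coupling induced by two random variables bounds `W_p`. -/
lemma wpReal_map_le {Ω : Type*} [MeasurableSpace Ω] {p : ℝ} (hp : 0 < p) (m : Measure Ω)
    {f g : Ω → ℝ} (hf : Measurable f) (hg : Measurable g) :
    wpReal p (m.map f) (m.map g) ≤ (∫⁻ x, edist (f x) (g x) ^ p ∂m) ^ (1 / p) := by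
  rw [wpReal_eq hp]
  refine (iInf₂_le (m.map fun x => (f x, g x)) ⟨?_, ?_⟩).trans_eq ?_
  · rw [lintegral_map (by fun_prop) (hf.prodMk hg)]
  · rw [Measure.map_map measurable_fst (hf.prodMk hg)]; rfl
  · rw [Measure.map_map measurable_snd (hf.prodMk hg)]; rfl

lemma wpPowReal_comm {p : ℝ} (hp : 0 < p) (μ ν : Measure ℝ) :
    wpPowReal p μ ν = wpPowReal p ν μ := by
  suffices h : ∀ μ ν : Measure ℝ, wpPowReal p μ ν ≤ wpPowReal p ν μ from
    le_antisymm (h _ _) (h _ _)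
  intro μ ν
  rw [wpPowReal_eq hp.le, wpPowReal_eq hp.le]
  refine le_iInf₂ fun γ hγ => (iInf₂_le (γ.map Prod.swap) ⟨?_, ?_⟩).trans_eq ?_
  · rw [lintegral_map (by fun_prop) measurable_swap]
    simp only [Prod.fst_swap, Prod.snd_swap, edist_comm]
  · rw [Measure.map_map measurable_fst measurable_swap]; exact hγ.2
  · rw [Measure.map_map measurable_snd measurable_swap]; exact hγ.1

lemma wpReal_comm {p : ℝ} (hp : 0 < p) (μ ν : Measure ℝ) :
    wpReal p μ ν = wpReal p ν μ := by
  rw [wpReal, wpReal, wpPowReal_comm hp]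

/-- Gluing of couplings along a common marginal. -/
lemma exists_gluing {γ₁ γ₂ : Measure (ℝ × ℝ)} [IsFiniteMeasure γ₁] [IsFiniteMeasure γ₂]
    (h : γ₁.map Prod.snd = γ₂.map Prod.fst) :
    ∃ τ : Measure (ℝ × ℝ × ℝ),
      τ.map (fun z => (z.2.1, z.1)) = γ₁ ∧ τ.map (fun z => (z.1, z.2.2)) = γ₂ := by
  set γ := γ₁.map Prod.swap with hγ
  have hfst : γ.fst = γ₂.fst := by
    rw [hγ, Measure.fst_map_swap]; exact h
  refine ⟨γ₂.fst ⊗ₘ (γ.condKernel ×ₖ γ₂.condKernel), ?_, ?_⟩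
  · have key : (γ₂.fst ⊗ₘ (γ.condKernel ×ₖ γ₂.condKernel)).map (Prod.map id Prod.fst) = γ := by
      rw [← Measure.compProd_map measurable_fst, ← Kernel.fst_eq, Kernel.fst_prod, ← hfst,
        γ.disintegrate]
    have h2 : γ.map Prod.swap = γ₁ := by
      rw [hγ, Measure.map_map measurable_swap measurable_swap]; simp
    refine Eq.trans ?_ ((congrArg (Measure.map Prod.swap) key).trans h2)
    rw [Measure.map_map measurable_swap (by fun_prop)]
    rfl
  · have key : (γ₂.fst ⊗ₘ (γ.condKernel ×ₖ γ₂.condKernel)).map (Prod.map id Prod.snd) = γ₂ := by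
      rw [← Measure.compProd_map measurable_snd, ← Kernel.snd_eq, Kernel.snd_prod,
        γ₂.disintegrate]
    exact key

lemma wpReal_triangle {p : ℝ} (hp : 1 ≤ p) (μ α ν : Measure ℝ) [IsFiniteMeasure α] :
    wpReal p μ ν ≤ wpReal p μ α + wpReal p α ν := by
  have hp0 : 0 < p := by linarith
  rw [wpReal_eq hp0 μ α, wpReal_eq hp0 α ν]
  refine le_iInf₂_add_iInf₂ fun γ₁ hγ₁ γ₂ hγ₂ => ?_
  have : IsFiniteMeasure γ₁ := by
    have : IsFiniteMeasure (γ₁.map Prod.snd) := by rw [hγ₁.2]; infer_instance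
    exact Measure.isFiniteMeasure_of_map measurable_snd.aemeasurable
  have : IsFiniteMeasure γ₂ := by
    have : IsFiniteMeasure (γ₂.map Prod.fst) := by rw [hγ₂.1]; infer_instance
    exact Measure.isFiniteMeasure_of_map measurable_fst.aemeasurable
  obtain ⟨τ, h₁, h₂⟩ := exists_gluing (hγ₁.2.trans hγ₂.1.symm)
  have hμ : τ.map (fun z => z.2.1) = μ := by
    rw [← hγ₁.1, ← h₁, Measure.map_map measurable_fst (by fun_prop)]; rfl
  have hν : τ.map (fun z => z.2.2) = ν := by
    rw [← hγ₂.2, ← h₂, Measure.map_map measurable_snd (by fun_prop)]; rfl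
  calc wpReal p μ ν
      ≤ (∫⁻ z, edist z.2.1 z.2.2 ^ p ∂τ) ^ (1 / p) := by
        rw [← hμ, ← hν]
        exact wpReal_map_le hp0 τ (by fun_prop) (by fun_prop)
    _ ≤ (∫⁻ z, ((fun z : ℝ × ℝ × ℝ => edist z.2.1 z.1) +
          fun z : ℝ × ℝ × ℝ => edist z.1 z.2.2) z ^ p ∂τ) ^ (1 / p) := by
        gcongr with z
        exact edist_triangle _ _ _
    _ ≤ (∫⁻ z, edist z.2.1 z.1 ^ p ∂τ) ^ (1 / p) +
          (∫⁻ z, edist z.1 z.2.2 ^ p ∂τ) ^ (1 / p) :=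
        lintegral_Lp_add_le (by fun_prop) (by fun_prop) hp
    _ = _ := by
        rw [← h₁, ← h₂, lintegral_map (by fun_prop) (by fun_prop),
          lintegral_map (by fun_prop) (by fun_prop)]

/-- `W_p` between the images of `μ` and `ν` under a common map is Lipschitz in that map. -/
lemma wpReal_map_le_add {E : Type*} [MeasurableSpace E] {p : ℝ} (hp : 1 ≤ p)
    (μ ν : Measure E) [IsFiniteMeasure μ] [IsFiniteMeasure ν]
    {f g : E → ℝ} (hf : Measurable f) (hg : Measurable g) :
    wpReal p (μ.map f) (ν.map f) ≤
      wpReal p (μ.map g) (ν.map g) + 2 * eLpNorm (f - g) (ENNReal.ofReal p) (μ + ν) := by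
  have hp0 : 0 < p := by linarith
  have key : ∀ m ≤ μ + ν, wpReal p (m.map f) (m.map g) ≤
      eLpNorm (f - g) (ENNReal.ofReal p) (μ + ν) := by
    intro m hm
    refine (wpReal_map_le hp0 m hf hg).trans ?_
    rw [eLpNorm_eq_lintegral_rpow_enorm_toReal (by simpa using hp0) ofReal_ne_top,
      toReal_ofReal hp0.le]
    simp only [edist_eq_enorm_sub, Pi.sub_apply]
    gcongr
  calc wpReal p (μ.map f) (ν.map f)
      ≤ wpReal p (μ.map f) (μ.map g) +
          (wpReal p (μ.map g) (ν.map g) + wpReal p (ν.map g) (ν.map f)) :=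
        (wpReal_triangle hp _ (μ.map g) _).trans
          (add_le_add_right (wpReal_triangle hp _ (ν.map g) _) _)
    _ ≤ eLpNorm (f - g) (ENNReal.ofReal p) (μ + ν) +
          (wpReal p (μ.map g) (ν.map g) + eLpNorm (f - g) (ENNReal.ofReal p) (μ + ν)) := by
        gcongr
        · exact key μ (Measure.le_add_right le_rfl)
        · rw [wpReal_comm hp0]; exact key ν (Measure.le_add_left le_rfl)
    _ = _ := by ring

lemma measurable_wpReal_map {E V : Type*} [MeasurableSpace E]
    [MeasurableSpace.CountablyGenerated E] [MeasurableSpace V] {p : ℝ} (hp : 1 ≤ p)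
    {P : V → E → ℝ} (hP : Measurable (Function.uncurry P))
    (μ ν : Measure E) [IsFiniteMeasure μ] [IsFiniteMeasure ν]
    (hmem : ∀ v, MemLp (P v) (ENNReal.ofReal p) (μ + ν)) :
    Measurable fun v => wpReal p (μ.map (P v)) (ν.map (P v)) := by
  have hp0 : 0 < p := by linarith
  have hq0 : ENNReal.ofReal p ≠ 0 := by simpa using hp0
  have : Fact (1 ≤ ENNReal.ofReal p) := ⟨by simpa using hp⟩
  have : Fact (ENNReal.ofReal p ≠ ⊤) := ⟨ofReal_ne_top⟩
  have hPv : ∀ v, Measurable (P v) := fun v => hP.of_uncurry_left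
  let u : ℕ → Lp ℝ (ENNReal.ofReal p) (μ + ν) := TopologicalSpace.denseSeq _
  have hu : ∀ n, Measurable (u n) := fun n => (Lp.stronglyMeasurable (u n)).measurable
  have heq : (fun v => wpReal p (μ.map (P v)) (ν.map (P v))) = fun v =>
      ⨅ n, (wpReal p (μ.map (u n)) (ν.map (u n)) +
        2 * eLpNorm (P v - ⇑(u n)) (ENNReal.ofReal p) (μ + ν)) := by
    funext v
    refine le_antisymm (le_iInf fun n => wpReal_map_le_add hp μ ν (hPv v) (hu n)) ?_
    refine ENNReal.le_of_forall_pos_le_add fun ε hε _ => ?_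
    obtain ⟨n, hn⟩ := Metric.denseRange_iff.1 (TopologicalSpace.denseRange_denseSeq
      (Lp ℝ (ENNReal.ofReal p) (μ + ν))) ((hmem v).toLp (P v)) (ε / 4) (by positivity)
    have hd : eLpNorm (P v - ⇑(u n)) (ENNReal.ofReal p) (μ + ν) ≤ (ε / 4 : NNReal) := by
      rw [← eLpNorm_congr_ae ((hmem v).coeFn_toLp.sub (ae_eq_refl (u n))), ← Lp.edist_def,
        edist_nndist]
      exact_mod_cast hn.le
    have hd' : eLpNorm (⇑(u n) - P v) (ENNReal.ofReal p) (μ + ν) ≤ (ε / 4 : NNReal) := by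
      rwa [eLpNorm_sub_comm]
    have hε4 : 2 * ((ε / 4 : NNReal) : ℝ≥0∞) + 2 * ((ε / 4 : NNReal) : ℝ≥0∞) = ε := by
      norm_cast
      ring
    calc _ ≤ wpReal p (μ.map (u n)) (ν.map (u n)) +
          2 * eLpNorm (P v - ⇑(u n)) (ENNReal.ofReal p) (μ + ν) := iInf_le _ n
      _ ≤ (wpReal p (μ.map (P v)) (ν.map (P v)) + 2 * (ε / 4 : NNReal)) +
          2 * (ε / 4 : NNReal) := by
        gcongr
        exact (wpReal_map_le_add hp μ ν (hu n) (hPv v)).trans (by gcongr)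
      _ = _ := by rw [add_assoc, hε4]
  rw [heq]
  refine .iInf fun n => measurable_const.add (measurable_const.mul ?_)
  simp only [eLpNorm_eq_lintegral_rpow_enorm_toReal hq0 ofReal_ne_top]
  refine Measurable.pow_const (Measurable.lintegral_prod_right' (f := fun z : V × E =>
    ‖(P z.1 - u n) z.2‖ₑ ^ (ENNReal.ofReal p).toReal) ?_) _
  exact ((hP.sub ((hu n).comp measurable_snd)).enorm).pow_const _

lemma chsw_eq {E V : Type*} [MeasurableSpace E] [MeasurableSpace V]
    (P : V → E → ℝ) (lam : Measure V) {p : ℝ} (hp : 0 < p) (μ ν : Measure E) :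
    chsw P lam p μ ν =
      (∫⁻ v, wpReal p (μ.map (P v)) (ν.map (P v)) ^ p ∂lam) ^ (1 / p) := by
  simp only [chsw, chswPow, wpReal, ← ENNReal.rpow_mul, one_div_mul_cancel hp.ne',
    ENNReal.rpow_one]

lemma memLp_of_lipschitzWith_one {E : Type*} [PseudoMetricSpace E] [MeasurableSpace E]
    [OpensMeasurableSpace E] {o : E} {p : ℝ} (hp : 0 < p) {f : E → ℝ}
    (hf : LipschitzWith 1 f) (hfo : f o = 0) {m : Measure E}
    (hm : ∫⁻ x, ENNReal.ofReal (dist x o ^ p) ∂m < ⊤) :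
    MemLp f (ENNReal.ofReal p) m ∧ eLpNorm f (ENNReal.ofReal p) m ≤
      (∫⁻ x, ENNReal.ofReal (dist x o ^ p) ∂m) ^ (1 / p) := by
  have h : eLpNorm f (ENNReal.ofReal p) m ≤
      (∫⁻ x, ENNReal.ofReal (dist x o ^ p) ∂m) ^ (1 / p) := by
    rw [eLpNorm_eq_lintegral_rpow_enorm_toReal (by simpa using hp) ofReal_ne_top,
      toReal_ofReal hp.le]
    gcongr with x
    rw [← ENNReal.ofReal_rpow_of_nonneg dist_nonneg hp.le, ← edist_dist]
    gcongr
    simpa [hfo] using hf x o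
  exact ⟨⟨hf.continuous.measurable.aestronglyMeasurable,
    h.trans_lt (ENNReal.rpow_lt_top_of_nonneg (by positivity) hm.ne)⟩, h⟩

/-- In the sliced setting, for every `p ≥ 1`, `CHSW_p` is a finite
pseudo-distance on `𝒫_p(E)`. -/
theorem chsw_pseudo_distance
    {E V : Type*} [MetricSpace E] [CompleteSpace E] [TopologicalSpace.SeparableSpace E]
    [MeasurableSpace E] [BorelSpace E] [MeasurableSpace V]
    (o : E) (lam : Measure V) [IsProbabilityMeasure lam]
    (P : V → E → ℝ) (hP : Measurable (Function.uncurry P))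
    (hLip : ∀ v, LipschitzWith 1 (P v)) (hPo : ∀ v, P v o = 0)
    (p : ℝ) (hp : 1 ≤ p)
    (μ ν α : Measure E) [IsProbabilityMeasure μ] [IsProbabilityMeasure ν]
    [IsProbabilityMeasure α]
    (hμ : ∫⁻ x, ENNReal.ofReal (dist x o ^ p) ∂μ < ⊤)
    (hν : ∫⁻ x, ENNReal.ofReal (dist x o ^ p) ∂ν < ⊤)
    (hα : ∫⁻ x, ENNReal.ofReal (dist x o ^ p) ∂α < ⊤) :
    chsw P lam p μ ν < ⊤ ∧
      0 ≤ chsw P lam p μ ν ∧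
      chsw P lam p μ μ = 0 ∧
      chsw P lam p μ ν = chsw P lam p ν μ ∧
      chsw P lam p μ ν ≤ chsw P lam p μ α + chsw P lam p α ν := by
  have hp0 : 0 < p := by linarith
  have hPv : ∀ v, Measurable (P v) := fun v => (hLip v).continuous.measurable
  have hadd : ∀ {m₁ m₂ : Measure E}, ∫⁻ x, ENNReal.ofReal (dist x o ^ p) ∂m₁ < ⊤ →
      ∫⁻ x, ENNReal.ofReal (dist x o ^ p) ∂m₂ < ⊤ →
      ∫⁻ x, ENNReal.ofReal (dist x o ^ p) ∂(m₁ + m₂) < ⊤ := fun h₁ h₂ => by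
    rw [lintegral_add_measure]; exact ENNReal.add_lt_top.2 ⟨h₁, h₂⟩
  have hself : ∀ (m : Measure E) (f : E → ℝ), Measurable f →
      wpReal p (m.map f) (m.map f) = 0 := fun m f hf => by
    simpa [hp0, hp0.le] using wpReal_map_le hp0 m hf hf
  have hmeas : ∀ (m₁ m₂ : Measure E) [IsProbabilityMeasure m₁] [IsProbabilityMeasure m₂],
      ∫⁻ x, ENNReal.ofReal (dist x o ^ p) ∂m₁ < ⊤ →
      ∫⁻ x, ENNReal.ofReal (dist x o ^ p) ∂m₂ < ⊤ →
      Measurable fun v => wpReal p (m₁.map (P v)) (m₂.map (P v)) := fun m₁ m₂ _ _ h₁ h₂ =>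
    measurable_wpReal_map hp hP m₁ m₂ fun v =>
      (memLp_of_lipschitzWith_one hp0 (hLip v) (hPo v) (hadd h₁ h₂)).1
  refine ⟨?_, zero_le, ?_, ?_, ?_⟩
  · rw [chsw_eq P lam hp0]
    set C := (∫⁻ x, ENNReal.ofReal (dist x o ^ p) ∂(μ + ν)) ^ (1 / p)
    have hCtop : C < ⊤ := ENNReal.rpow_lt_top_of_nonneg (by positivity) (hadd hμ hν).ne
    have hbound : ∀ v, wpReal p (μ.map (P v)) (ν.map (P v)) ≤ 2 * C := fun v => by
      have hzero : wpReal p (μ.map fun _ => (0 : ℝ)) (ν.map fun _ => (0 : ℝ)) = 0 := by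
        have := hself μ (fun _ => 0) measurable_const
        simpa [Measure.map_const] using this
      refine (wpReal_map_le_add hp μ ν (hPv v) (measurable_const (a := (0 : ℝ)))).trans ?_
      rw [hzero, zero_add]
      gcongr
      have hsub : (P v - fun _ => (0 : ℝ)) = P v := by funext x; simp
      rw [hsub]
      exact (memLp_of_lipschitzWith_one hp0 (hLip v) (hPo v) (hadd hμ hν)).2
    refine ENNReal.rpow_lt_top_of_nonneg (by positivity) (ne_of_lt ?_)
    calc ∫⁻ v, wpReal p (μ.map (P v)) (ν.map (P v)) ^ p ∂lam
        ≤ ∫⁻ _, (2 * C) ^ p ∂lam := by gcongr with v; exact hbound v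
      _ = (2 * C) ^ p := by simp
      _ < ⊤ := ENNReal.rpow_lt_top_of_nonneg hp0.le
          (ENNReal.mul_ne_top ENNReal.ofNat_ne_top hCtop.ne)
  · simp [chsw_eq P lam hp0, hself μ _ (hPv _), hp0]
  · simp only [chsw, chswPow, wpPowReal_comm hp0 (μ.map _)]
  · simp only [chsw_eq P lam hp0]
    refine le_trans ?_ (lintegral_Lp_add_le (hmeas μ α hμ hα).aemeasurable
      (hmeas α ν hα hν).aemeasurable hp)
    gcongr with v
    have := Measure.isProbabilityMeasure_map (μ := α) (hPv v).aemeasurable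
    exact wpReal_triangle hp _ _ _
end

section
/- In the sliced setting, for every p ≥ 1 and all μ, ν ∈ 𝒫_p(E), CHSW_p^p(μ, ν) ≤ W_p^p(μ, ν), where W_p is the Wasserstein distance on (E,d). -/
open MeasureTheory ENNReal

/-- `W_p^p` on a metric space, with ground cost `dist x y ^ p`. -/
noncomputable def wpPow {X : Type*} [PseudoMetricSpace X] [MeasurableSpace X]
    (p : ℝ) (μ ν : Measure X) : ℝ≥0∞ :=
  transportCost (fun x y => ENNReal.ofReal (dist x y ^ p)) μ ν

/-- A measurable map that does not increase the cost does not increase the transport cost. -/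
theorem transportCost_map_le {X Y : Type*} [MeasurableSpace X] [MeasurableSpace Y]
    {c : X → X → ℝ≥0∞} {d : Y → Y → ℝ≥0∞} {f : X → Y} (hf : Measurable f)
    (hd : Measurable (Function.uncurry d)) (h : ∀ x y, d (f x) (f y) ≤ c x y)
    (μ ν : Measure X) :
    transportCost d (μ.map f) (ν.map f) ≤ transportCost c μ ν := by
  refine le_iInf₂ fun γ ⟨hγ₁, hγ₂⟩ => ?_
  have hff : Measurable (Prod.map f f) := hf.prodMap hf
  refine iInf₂_le_of_le (γ.map (Prod.map f f)) ⟨?_, ?_⟩ ?_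
  · rw [Measure.map_map measurable_fst hff, ← hγ₁, Measure.map_map hf measurable_fst]
    rfl
  · rw [Measure.map_map measurable_snd hff, ← hγ₂, Measure.map_map hf measurable_snd]
    rfl
  · exact (lintegral_map hd hff).trans_le (lintegral_mono fun z => h z.1 z.2)

/-- In the sliced setting, for every `p ≥ 1` and all `μ, ν ∈ 𝒫_p(E)`,
`CHSW_p^p(μ, ν) ≤ W_p^p(μ, ν)`. -/
theorem chswPow_le_wassersteinPow
    {E V : Type*} [MetricSpace E] [CompleteSpace E] [TopologicalSpace.SeparableSpace E]
    [MeasurableSpace E] [BorelSpace E] [MeasurableSpace V]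
    (o : E) (lam : Measure V) [IsProbabilityMeasure lam]
    (P : V → E → ℝ) (hP : Measurable (Function.uncurry P))
    (hLip : ∀ v, LipschitzWith 1 (P v)) (hPo : ∀ v, P v o = 0)
    (p : ℝ) (hp : 1 ≤ p)
    (μ ν : Measure E) [IsProbabilityMeasure μ] [IsProbabilityMeasure ν]
    (hμ : ∫⁻ x, ENNReal.ofReal (dist x o ^ p) ∂μ < ⊤)
    (hν : ∫⁻ x, ENNReal.ofReal (dist x o ^ p) ∂ν < ⊤) :
    chswPow P lam p μ ν ≤ wpPow p μ ν := by
  have key : ∀ v, wpPowReal p (μ.map (P v)) (ν.map (P v)) ≤ wpPow p μ ν := fun v =>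
    transportCost_map_le (hLip v).continuous.measurable (by fun_prop) (fun x y => by
      have hxy : |P v x - P v y| ≤ dist x y := by
        simpa [Real.dist_eq] using (hLip v).dist_le_mul x y
      gcongr) μ ν
  calc chswPow P lam p μ ν ≤ ∫⁻ _, wpPow p μ ν ∂lam := lintegral_mono key
    _ = wpPow p μ ν := by simp
end

section
/- In the sliced setting, for every γ > 0 the kernel K(μ, ν) = exp(−γ · CHSW_2^2(μ, ν)) is positive definite on 𝒫_2(E): for every n ∈ ℕ, all μ_1, …, μ_n ∈ 𝒫_2(E) and all c_1, …, c_n ∈ ℝ, Σ_{i=1}^n Σ_{j=1}^n c_i c_j exp(−γ · CHSW_2^2(μ_i, μ_j)) ≥ 0. -/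
open MeasureTheory ENNReal

/-- The entrywise exponential of a positive semidefinite real matrix defines a nonnegative
quadratic form. -/
theorem Matrix.PosSemidef.sum_mul_exp_nonneg {ι : Type*} [Fintype ι] {M : Matrix ι ι ℝ}
    (hM : M.PosSemidef) (c : ι → ℝ) :
    0 ≤ ∑ i, ∑ j, c i * c j * Real.exp (M i j) := by
  have hpow : ∀ k : ℕ, (Matrix.of fun i j => M i j ^ k).PosSemidef := by
    intro k
    induction k with
    | zero =>
      convert Matrix.posSemidef_vecMulVec_self_star (fun _ : ι => (1 : ℝ)) using 1
      ext i j
      simp [Matrix.vecMulVec_apply]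
    | succ k ih =>
      have heq : (Matrix.of fun i j => M i j ^ (k + 1))
          = Matrix.hadamard (Matrix.of fun i j => M i j ^ k) M := by
        ext i j
        simp [pow_succ]
      rw [heq]
      exact ih.hadamard hM
  have hsum : HasSum (fun k : ℕ => ∑ i, ∑ j, c i * c j * (M i j ^ k / k.factorial))
      (∑ i, ∑ j, c i * c j * Real.exp (M i j)) := by
    refine hasSum_sum fun i _ => hasSum_sum fun j _ => HasSum.mul_left _ ?_
    rw [Real.exp_eq_exp_ℝ]
    exact NormedSpace.expSeries_div_hasSum_exp (M i j)
  refine hsum.nonneg fun k => ?_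
  have h := (hpow k).dotProduct_mulVec_nonneg c
  have heq : ∑ i, ∑ j, c i * c j * (M i j ^ k / k.factorial)
      = (∑ i, ∑ j, c i * c j * M i j ^ k) / k.factorial := by
    simp_rw [Finset.sum_div, mul_div_assoc]
  rw [heq]
  refine div_nonneg ?_ (Nat.cast_nonneg _)
  convert h using 1
  simp only [dotProduct, Matrix.mulVec, Matrix.of_apply, Finset.mul_sum, Pi.star_apply, star_trivial]
  exact Finset.sum_congr rfl fun i _ => Finset.sum_congr rfl fun j _ => by ring

/-- The Gaussian kernel on a real inner product space is positive definite. -/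
theorem sum_mul_exp_neg_norm_sub_sq_nonneg {H ι : Type*} [NormedAddCommGroup H]
    [InnerProductSpace ℝ H] [Fintype ι] {γ : ℝ} (hγ : 0 ≤ γ) (x : ι → H) (c : ι → ℝ) :
    0 ≤ ∑ i, ∑ j, c i * c j * Real.exp (-γ * ‖x i - x j‖ ^ 2) := by
  have h := ((Matrix.posSemidef_gram ℝ x).smul (show 0 ≤ 2 * γ by positivity)).sum_mul_exp_nonneg
    (fun i => c i * Real.exp (-γ * ‖x i‖ ^ 2))
  refine h.trans_eq (Finset.sum_congr rfl fun i _ => Finset.sum_congr rfl fun j _ => ?_)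
  rw [Matrix.smul_apply, Matrix.gram_apply, smul_eq_mul, norm_sub_sq_real,
    show -γ * (‖x i‖ ^ 2 - 2 * inner ℝ (x i) (x j) + ‖x j‖ ^ 2)
      = -γ * ‖x i‖ ^ 2 + -γ * ‖x j‖ ^ 2 + 2 * γ * inner ℝ (x i) (x j) by ring,
    Real.exp_add, Real.exp_add]
  ring

/-- The quantile function of a measure on `ℝ`, extended by `0` outside `(0, 1)`. -/
noncomputable def quantile (μ : Measure ℝ) : ℝ → ℝ :=
  (Set.Ioo (0 : ℝ) 1).indicator fun u => sInf {t | u ≤ ProbabilityTheory.cdf μ t}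

/-- The uniform distribution on `(0, 1)`. -/
noncomputable def unitUniform : Measure ℝ := volume.restrict (Set.Ioo 0 1)

instance : IsProbabilityMeasure unitUniform := ⟨by simp [unitUniform]⟩

theorem quantile_le_iff (μ : Measure ℝ) {u : ℝ} (hu : u ∈ Set.Ioo (0 : ℝ) 1) (t : ℝ) :
    quantile μ u ≤ t ↔ u ≤ ProbabilityTheory.cdf μ t := by
  rw [quantile, Set.indicator_of_mem hu]
  have hne : {t | u ≤ ProbabilityTheory.cdf μ t}.Nonempty :=
    (((ProbabilityTheory.tendsto_cdf_atTop μ).eventually (lt_mem_nhds hu.2)).exists).imp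
      fun _ h => le_of_lt h
  have hbdd : BddBelow {t | u ≤ ProbabilityTheory.cdf μ t} := by
    obtain ⟨a, ha⟩ :=
      ((ProbabilityTheory.tendsto_cdf_atBot μ).eventually (gt_mem_nhds hu.1)).exists
    exact ⟨a, fun t ht => le_of_lt ((ProbabilityTheory.monotone_cdf μ).reflect_lt (ha.trans_le ht))⟩
  refine ⟨fun h => ?_, fun h => csInf_le hbdd h⟩
  have hright := ((ProbabilityTheory.cdf μ).right_continuous t).mono_left
    (nhdsWithin_mono t Set.Ioi_subset_Ici_self)
  refine ge_of_tendsto hright ?_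
  filter_upwards [self_mem_nhdsWithin] with s hs
  obtain ⟨r, hr, hrs⟩ := (csInf_lt_iff hbdd hne).1 (h.trans_lt hs)
  exact le_trans hr (ProbabilityTheory.monotone_cdf μ hrs.le)

theorem measurable_uncurry_quantile {V : Type*} [MeasurableSpace V] {m : V → Measure ℝ}
    (hm : ∀ t, Measurable fun v => ProbabilityTheory.cdf (m v) t) :
    Measurable (Function.uncurry fun v => quantile (m v)) := by
  refine measurable_of_Iic fun t => ?_
  have hset : (Function.uncurry fun v => quantile (m v)) ⁻¹' Set.Iic t
      = {z : V × ℝ | z.2 ∈ Set.Ioo (0 : ℝ) 1 ∧ z.2 ≤ ProbabilityTheory.cdf (m z.1) t}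
        ∪ {z : V × ℝ | z.2 ∉ Set.Ioo (0 : ℝ) 1 ∧ 0 ≤ t} := by
    ext ⟨v, u⟩
    by_cases hu : u ∈ Set.Ioo (0 : ℝ) 1
    · simp only [Set.mem_preimage, Function.uncurry_apply_pair, Set.mem_Iic, quantile_le_iff _ hu]
      simp [hu.1, hu.2]
    · simp only [Set.mem_preimage, Function.uncurry_apply_pair, Set.mem_Iic, quantile,
        Set.indicator_of_notMem hu]
      simp only [Set.mem_union, Set.mem_ofPred_eq, hu]
      simp
  rw [hset]
  have hI : MeasurableSet {z : V × ℝ | z.2 ∈ Set.Ioo (0 : ℝ) 1} := measurable_snd measurableSet_Ioo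
  exact (hI.inter (measurableSet_le measurable_snd ((hm t).comp measurable_fst))).union
    (hI.compl.inter (MeasurableSet.const _))

theorem measurable_quantile (μ : Measure ℝ) : Measurable (quantile μ) :=
  (measurable_uncurry_quantile (V := Unit) (m := fun _ => μ)
    fun _ => measurable_const).of_uncurry_left (x := ())

theorem map_quantile (μ : Measure ℝ) [IsProbabilityMeasure μ] :
    unitUniform.map (quantile μ) = μ := by
  have : IsProbabilityMeasure (unitUniform.map (quantile μ)) :=
    Measure.isProbabilityMeasure_map (measurable_quantile μ).aemeasurable
  refine Measure.ext_of_Iic _ _ fun t => ?_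
  have hpre : MeasurableSet (quantile μ ⁻¹' Set.Iic t) := measurable_quantile μ measurableSet_Iic
  rw [Measure.map_apply (measurable_quantile μ) measurableSet_Iic, unitUniform,
    Measure.restrict_apply hpre]
  have hset : quantile μ ⁻¹' Set.Iic t ∩ Set.Ioo 0 1
      = Set.Iic (ProbabilityTheory.cdf μ t) ∩ Set.Ioo 0 1 := by
    ext u
    simp only [Set.mem_inter_iff, Set.mem_preimage, Set.mem_Iic]
    exact and_congr_left fun hu => quantile_le_iff μ hu t
  rw [hset, ← Measure.restrict_apply measurableSet_Iic,
    Measure.restrict_congr_set Ioo_ae_eq_Ioc, Measure.restrict_apply measurableSet_Iic,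
    Set.inter_comm, Set.Ioc_inter_Iic, min_eq_right (ProbabilityTheory.cdf_le_one μ t),
    Real.volume_Ioc, sub_zero, ProbabilityTheory.ofReal_cdf]

/-- The pairs of levels separating `z.1` from `z.2 > z.1`. -/
def separatingLevels (z : ℝ × ℝ) : Set (ℝ × ℝ) :=
  {p | z.1 ≤ min p.1 p.2 ∧ max p.1 p.2 < z.2}

theorem volume_separatingLevels (z : ℝ × ℝ) :
    volume (separatingLevels z) = ENNReal.ofReal (z.2 - z.1) ^ 2 := by
  have : separatingLevels z = Set.Ico z.1 z.2 ×ˢ Set.Ico z.1 z.2 := by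
    ext p
    simp only [separatingLevels, Set.mem_ofPred_eq, le_min_iff, max_lt_iff, Set.mem_prod, Set.mem_Ico]
    tauto
  rw [this, Measure.volume_eq_prod, Measure.prod_prod, Real.volume_Ico, sq]

theorem ofReal_abs_sub_rpow_two (x y : ℝ) :
    ENNReal.ofReal (|x - y| ^ (2 : ℝ)) = ENNReal.ofReal (y - x) ^ 2 + ENNReal.ofReal (x - y) ^ 2 := by
  rw [Real.rpow_two]
  rcases le_total x y with h | h
  · rw [ENNReal.ofReal_of_nonpos (sub_nonpos.2 h), abs_sub_comm, abs_of_nonneg (sub_nonneg.2 h),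
      ENNReal.ofReal_pow (sub_nonneg.2 h)]
    simp
  · rw [ENNReal.ofReal_of_nonpos (sub_nonpos.2 h), abs_of_nonneg (sub_nonneg.2 h),
      ENNReal.ofReal_pow (sub_nonneg.2 h)]
    simp

theorem measurableSet_le_and_lt {α : Type*} [MeasurableSpace α] {f g h k : α → ℝ}
    (hf : Measurable f) (hg : Measurable g) (hh : Measurable h) (hk : Measurable k) :
    MeasurableSet {a | f a ≤ g a ∧ h a < k a} :=
  (measurableSet_le hf hg).inter (measurableSet_lt hh hk)

theorem lintegral_ofReal_sub_sq (γ : Measure (ℝ × ℝ)) [SFinite γ] :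
    ∫⁻ z, ENNReal.ofReal (z.2 - z.1) ^ 2 ∂γ
      = ∫⁻ p : ℝ × ℝ, γ {z | z.1 ≤ min p.1 p.2 ∧ max p.1 p.2 < z.2} := by
  have hS : MeasurableSet {w : (ℝ × ℝ) × (ℝ × ℝ) | w.2 ∈ separatingLevels w.1} :=
    measurableSet_le_and_lt (f := fun w : (ℝ × ℝ) × (ℝ × ℝ) => w.1.1) (g := fun w => min w.2.1 w.2.2)
      (h := fun w => max w.2.1 w.2.2) (k := fun w => w.1.2)
      (by fun_prop) (by fun_prop) (by fun_prop) (by fun_prop)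
  simp_rw [← volume_separatingLevels]
  exact (Measure.prod_apply hS).symm.trans (Measure.prod_apply_symm hS)

theorem lintegral_sq_cost_eq (γ : Measure (ℝ × ℝ)) [SFinite γ] :
    ∫⁻ z, ENNReal.ofReal (|z.1 - z.2| ^ (2 : ℝ)) ∂γ
      = (∫⁻ p : ℝ × ℝ, γ {z | z.1 ≤ min p.1 p.2 ∧ max p.1 p.2 < z.2})
        + ∫⁻ p : ℝ × ℝ, γ {z | z.2 ≤ min p.1 p.2 ∧ max p.1 p.2 < z.1} := by
  simp_rw [ofReal_abs_sub_rpow_two]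
  rw [lintegral_add_left (by fun_prop), lintegral_ofReal_sub_sq]
  congr 1
  have h := lintegral_ofReal_sub_sq (γ.map Prod.swap)
  rw [lintegral_map (by fun_prop) measurable_swap] at h
  refine h.trans (lintegral_congr fun p => ?_)
  rw [Measure.map_apply measurable_swap]
  · rfl
  · exact measurableSet_le_and_lt measurable_fst measurable_const measurable_const measurable_snd

theorem quantile_joint_le (μ ν : Measure ℝ) [IsProbabilityMeasure μ] [IsProbabilityMeasure ν]
    (s t : ℝ) :
    unitUniform {u | quantile μ u ≤ s ∧ t < quantile ν u} ≤ μ (Set.Iic s) - ν (Set.Iic t) := by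
  have hset : {u | quantile μ u ≤ s ∧ t < quantile ν u} ∩ Set.Ioo 0 1
      ⊆ Set.Ioc (ProbabilityTheory.cdf ν t) (ProbabilityTheory.cdf μ s) := by
    rintro u ⟨⟨h1, h2⟩, hu⟩
    exact ⟨not_le.1 fun h => h2.not_ge ((quantile_le_iff ν hu t).2 h), (quantile_le_iff μ hu s).1 h1⟩
  rw [unitUniform, Measure.restrict_apply' measurableSet_Ioo]
  refine (measure_mono hset).trans_eq ?_
  rw [Real.volume_Ioc, ENNReal.ofReal_sub _ (ProbabilityTheory.cdf_nonneg ν t),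
    ProbabilityTheory.ofReal_cdf, ProbabilityTheory.ofReal_cdf]

theorem sub_le_coupling {α : Type*} [MeasurableSpace α] (γ : Measure α) {f g : α → ℝ}
    (hf : Measurable f) (hg : Measurable g) (s t : ℝ) :
    γ.map f (Set.Iic s) - γ.map g (Set.Iic t) ≤ γ {z | f z ≤ s ∧ t < g z} := by
  rw [Measure.map_apply hf measurableSet_Iic, Measure.map_apply hg measurableSet_Iic]
  refine le_measure_sdiff.trans (measure_mono ?_)
  rintro z ⟨h1, h2⟩
  exact ⟨h1, not_le.1 h2⟩

/-- The monotone coupling is optimal for the quadratic cost on the real line. -/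
theorem wpPowReal_two_eq (μ ν : Measure ℝ) [IsProbabilityMeasure μ] [IsProbabilityMeasure ν] :
    wpPowReal 2 μ ν
      = ∫⁻ u, ENNReal.ofReal (|quantile μ u - quantile ν u| ^ (2 : ℝ)) ∂unitUniform := by
  have hq : Measurable fun u => (quantile μ u, quantile ν u) :=
    (measurable_quantile μ).prodMk (measurable_quantile ν)
  have hmap : ∫⁻ u, ENNReal.ofReal (|quantile μ u - quantile ν u| ^ (2 : ℝ)) ∂unitUniform
      = ∫⁻ z, ENNReal.ofReal (|z.1 - z.2| ^ (2 : ℝ))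
          ∂(unitUniform.map fun u => (quantile μ u, quantile ν u)) := by
    rw [lintegral_map (by fun_prop) hq]
  rw [wpPowReal, transportCost, hmap]
  apply le_antisymm
  · refine iInf₂_le _ ⟨?_, ?_⟩
    · rw [Measure.map_map measurable_fst hq]
      exact map_quantile μ
    · rw [Measure.map_map measurable_snd hq]
      exact map_quantile ν
  · refine le_iInf₂ fun γ hγ => ?_
    obtain ⟨h1, h2⟩ := hγ
    have hγfin : IsProbabilityMeasure γ := by
      refine ⟨?_⟩
      rw [← Set.preimage_univ (f := Prod.fst), ← Measure.map_apply measurable_fst MeasurableSet.univ,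
        h1, measure_univ]
    have hpre : ∀ S : Set (ℝ × ℝ), MeasurableSet S →
        unitUniform.map (fun u => (quantile μ u, quantile ν u)) S
          = unitUniform {u | (quantile μ u, quantile ν u) ∈ S} :=
      fun S hS => Measure.map_apply hq hS
    rw [lintegral_sq_cost_eq, lintegral_sq_cost_eq]
    refine add_le_add (lintegral_mono fun p => ?_) (lintegral_mono fun p => ?_)
    · rw [hpre _ (measurableSet_le_and_lt measurable_fst measurable_const measurable_const
        measurable_snd)]
      refine (quantile_joint_le μ ν _ _).trans ?_
      have := sub_le_coupling γ measurable_fst measurable_snd (min p.1 p.2) (max p.1 p.2)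
      rwa [h1, h2] at this
    · rw [hpre _ (measurableSet_le_and_lt measurable_snd measurable_const measurable_const
        measurable_fst)]
      refine (quantile_joint_le ν μ _ _).trans ?_
      have := sub_le_coupling γ measurable_snd measurable_fst (min p.1 p.2) (max p.1 p.2)
      rwa [h1, h2] at this

theorem measurable_uncurry_quantile_map {E V : Type*} [MeasurableSpace E] [MeasurableSpace V]
    {P : V → E → ℝ} (hP : Measurable (Function.uncurry P)) (μ : Measure E)
    [IsProbabilityMeasure μ] :
    Measurable (Function.uncurry fun v => quantile (μ.map (P v))) := by
  refine measurable_uncurry_quantile fun t => ?_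
  have hcdf : ∀ v, ProbabilityTheory.cdf (μ.map (P v)) t
      = (μ (Prod.mk v ⁻¹' (Function.uncurry P ⁻¹' Set.Iic t))).toReal := by
    intro v
    have hv : Measurable (P v) := hP.of_uncurry_left
    have := Measure.isProbabilityMeasure_map (μ := μ) hv.aemeasurable
    rw [ProbabilityTheory.cdf_eq_real, measureReal_def, Measure.map_apply hv measurableSet_Iic]
    rfl
  simp_rw [hcdf]
  exact (measurable_measure_prodMk_left (hP measurableSet_Iic)).ennreal_toReal

theorem memLp_two_quantile_map {E V : Type*} [MetricSpace E] [MeasurableSpace E]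
    [MeasurableSpace V] {o : E} {lam : Measure V} [IsProbabilityMeasure lam] {P : V → E → ℝ}
    (hP : Measurable (Function.uncurry P)) (hLip : ∀ v, LipschitzWith 1 (P v))
    (hPo : ∀ v, P v o = 0) {μ : Measure E} [IsProbabilityMeasure μ]
    (hmom : ∫⁻ x, ENNReal.ofReal (dist x o ^ (2 : ℝ)) ∂μ < ⊤) :
    MemLp (Function.uncurry fun v => quantile (μ.map (P v))) 2 (lam.prod unitUniform) := by
  have hmeas := measurable_uncurry_quantile_map hP μ
  refine ⟨hmeas.aestronglyMeasurable, ?_⟩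
  rw [eLpNorm_lt_top_iff_lintegral_rpow_enorm_lt_top two_ne_zero ENNReal.ofNat_ne_top]
  simp only [ENNReal.toReal_ofNat]
  rw [lintegral_prod _ (hmeas.enorm.pow_const _).aemeasurable]
  refine lt_of_le_of_lt (lintegral_mono (g := fun _ => ∫⁻ x, ENNReal.ofReal (dist x o ^ (2 : ℝ)) ∂μ)
    fun v => ?_) (by simpa using hmom)
  have hv : Measurable (P v) := hP.of_uncurry_left
  have := Measure.isProbabilityMeasure_map (μ := μ) hv.aemeasurable
  calc ∫⁻ u, ‖quantile (μ.map (P v)) u‖ₑ ^ (2 : ℝ) ∂unitUniform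
      = ∫⁻ y, ‖y‖ₑ ^ (2 : ℝ) ∂(unitUniform.map (quantile (μ.map (P v)))) := by
        rw [lintegral_map (by fun_prop) (measurable_quantile _)]
    _ = ∫⁻ x, ‖P v x‖ₑ ^ (2 : ℝ) ∂μ := by
        rw [map_quantile, lintegral_map (by fun_prop) hv]
    _ ≤ ∫⁻ x, ENNReal.ofReal (dist x o ^ (2 : ℝ)) ∂μ := by
        refine lintegral_mono fun x => ?_
        rw [← ENNReal.ofReal_rpow_of_nonneg dist_nonneg zero_le_two, ← ofReal_norm]
        gcongr
        simpa [Real.dist_eq, hPo] using (hLip v).dist_le_mul x o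

theorem chswPow_two_toReal_eq {E V : Type*} [MeasurableSpace E] [MeasurableSpace V]
    {lam : Measure V} [IsProbabilityMeasure lam] {P : V → E → ℝ}
    (hP : Measurable (Function.uncurry P)) {μ ν : Measure E} [IsProbabilityMeasure μ]
    [IsProbabilityMeasure ν]
    (hμ : MemLp (Function.uncurry fun v => quantile (μ.map (P v))) 2 (lam.prod unitUniform))
    (hν : MemLp (Function.uncurry fun v => quantile (ν.map (P v))) 2 (lam.prod unitUniform)) :
    (chswPow P lam 2 μ ν).toReal = ‖hμ.toLp _ - hν.toLp _‖ ^ 2 := by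
  have hmeas := (measurable_uncurry_quantile_map hP μ).sub (measurable_uncurry_quantile_map hP ν)
  rw [← MemLp.toLp_sub, Lp.norm_toLp, ← ENNReal.toReal_pow,
    eLpNorm_eq_lintegral_rpow_enorm_toReal two_ne_zero ENNReal.ofNat_ne_top]
  simp only [ENNReal.toReal_ofNat]
  rw [← ENNReal.rpow_natCast, ← ENNReal.rpow_mul]
  norm_num only [ENNReal.rpow_one]
  rw [lintegral_prod _ (hmeas.enorm.pow_const _).aemeasurable, chswPow]
  congr 1
  refine lintegral_congr fun v => ?_
  have hv : Measurable (P v) := hP.of_uncurry_left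
  have := Measure.isProbabilityMeasure_map (μ := μ) hv.aemeasurable
  have := Measure.isProbabilityMeasure_map (μ := ν) hv.aemeasurable
  rw [wpPowReal_two_eq]
  refine lintegral_congr fun u => ?_
  rw [← ENNReal.ofReal_rpow_of_nonneg (abs_nonneg _) zero_le_two, ← Real.norm_eq_abs,
    ofReal_norm]
  rfl

/-- In the sliced setting, for every `γ > 0` the Gaussian-type kernel
`K(μ, ν) = exp(-γ · CHSW_2^2(μ, ν))` is positive definite on `𝒫_2(E)`. -/
theorem chsw_gaussian_kernel_posdef
    {E V : Type*} [MetricSpace E] [CompleteSpace E] [TopologicalSpace.SeparableSpace E]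
    [MeasurableSpace E] [BorelSpace E] [MeasurableSpace V]
    (o : E) (lam : Measure V) [IsProbabilityMeasure lam]
    (P : V → E → ℝ) (hP : Measurable (Function.uncurry P))
    (hLip : ∀ v, LipschitzWith 1 (P v)) (hPo : ∀ v, P v o = 0)
    (γ : ℝ) (hγ : 0 < γ)
    (n : ℕ) (μs : Fin n → Measure E)
    (hprob : ∀ i, IsProbabilityMeasure (μs i))
    (hmom : ∀ i, ∫⁻ x, ENNReal.ofReal (dist x o ^ (2 : ℝ)) ∂(μs i) < ⊤)
    (c : Fin n → ℝ) :
    0 ≤ ∑ i, ∑ j,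
        c i * c j * Real.exp (-γ * (chswPow P lam 2 (μs i) (μs j)).toReal) := by
  have hLp : ∀ i, MemLp (Function.uncurry fun v => quantile ((μs i).map (P v))) 2
      (lam.prod unitUniform) := fun i =>
    have := hprob i
    memLp_two_quantile_map hP hLip hPo (hmom i)
  have hdist : ∀ i j, (chswPow P lam 2 (μs i) (μs j)).toReal
      = ‖(hLp i).toLp _ - (hLp j).toLp _‖ ^ 2 := fun i j =>
    have := hprob i
    have := hprob j
    chswPow_two_toReal_eq hP (hLp i) (hLp j)
  simp_rw [hdist]
  exact sum_mul_exp_neg_norm_sub_sq_nonneg hγ.le (fun i => (hLp i).toLp _) c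
end

section
/- In the pullback Euclidean setting, with P^v(x) = ⟨φ(x) − φ(o), v⟩ for v ∈ S^{d−1} and CHSW_p^p(μ,ν) = ∫_{S^{d−1}} W_p^p(P^v_#μ, P^v_#ν) dσ(v), let p ≥ 1 and r > 0, and let B(o,r) = {x ∈ M : d(x,o) ≤ r} be the closed ball of radius r. Then there exists a constant C_{d,p,r} depending only on d, p, r such that for all μ, ν ∈ 𝒫_p(M) supported in B(o,r), W_p^p(μ, ν) ≤ C_{d,p,r} · CHSW_p(μ, ν)^{1/(d+1)}. -/
open MeasureTheory ENNReal
open scoped RealInnerProductSpace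

/-- The pullback distance `d(x,y) = ‖φ(x) - φ(y)‖` on `M`. -/
noncomputable def pullbackDist {d : ℕ} {M : Type*}
    (φ : M ≃ EuclideanSpace ℝ (Fin d)) (x y : M) : ℝ :=
  ‖φ x - φ y‖

/-- The uniform probability measure on the unit sphere `S^{d-1}` of `ℝ^d`. -/
noncomputable def sphereUniform (d : ℕ) :
    Measure (Metric.sphere (0 : EuclideanSpace ℝ (Fin d)) 1) :=
  ((volume : Measure (EuclideanSpace ℝ (Fin d))).toSphere Set.univ)⁻¹ •
    (volume : Measure (EuclideanSpace ℝ (Fin d))).toSphere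

/-- `CHSW_p^p` in the pullback Euclidean setting, with projections
`P^v(x) = ⟪φ(x) - φ(o), v⟫` and directions uniform on the sphere. -/
noncomputable def chswPowPullback {d : ℕ} {M : Type*} [MeasurableSpace M]
    (φ : M ≃ EuclideanSpace ℝ (Fin d)) (o : M) (p : ℝ) (μ ν : Measure M) : ℝ≥0∞ :=
  ∫⁻ v : Metric.sphere (0 : EuclideanSpace ℝ (Fin d)) 1,
    wpPowReal p (μ.map fun x => ⟪φ x - φ o, (v : EuclideanSpace ℝ (Fin d))⟫)
      (ν.map fun x => ⟪φ x - φ o, (v : EuclideanSpace ℝ (Fin d))⟫) ∂(sphereUniform d)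

/-- `CHSW_p` in the pullback Euclidean setting. -/
noncomputable def chswPullback {d : ℕ} {M : Type*} [MeasurableSpace M]
    (φ : M ≃ EuclideanSpace ℝ (Fin d)) (o : M) (p : ℝ) (μ ν : Measure M) : ℝ≥0∞ :=
  (chswPowPullback φ o p μ ν) ^ (1 / p)

/-- `W_p^p` on `M` with the pullback ground cost `‖φ(x) - φ(y)‖^p`. -/
noncomputable def wpPowPullback {d : ℕ} {M : Type*} [MeasurableSpace M]
    (φ : M ≃ EuclideanSpace ℝ (Fin d)) (p : ℝ) (μ ν : Measure M) : ℝ≥0∞ :=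
  transportCost (fun x y => ENNReal.ofReal (pullbackDist φ x y ^ p)) μ ν

/-- Kantorovich duality on a finite set, for a cost satisfying the triangle inequality. -/
theorem exists_coupling_matrix_sum_le {ι : Type*} [Fintype ι] (a b : ι → ℝ) (c : ι → ι → ℝ)
    (hself : ∀ i, c i i = 0) (htri : ∀ i j k, c i k ≤ c i j + c j k) (K : ℝ)
    (hK : ∀ τ : ℝ, 0 ≤ τ → ∀ f : ι → ℝ, (∀ i j, f i - f j ≤ τ * c i j) →
      ∑ i, f i * (a i - b i) ≤ τ * K) (ha : ∀ i, 0 ≤ a i) (hb : ∀ i, 0 ≤ b i)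
    (hane : ∑ i, a i = 1) :
    ∃ γ : ι × ι → ℝ, (∀ z, 0 ≤ γ z) ∧ (∀ i, ∑ j, γ (i, j) = a i) ∧ (∀ j, ∑ i, γ (i, j) = b j) ∧
      ∑ z, γ z * c z.1 z.2 ≤ K := by
  classical
  have hne : Nonempty ι := by
    by_contra h
    rw [not_nonempty_iff] at h
    simp at hane
  let A : ι × ι → (ι → ℝ) × (ι → ℝ) × ℝ := fun z => (Pi.single z.1 1, Pi.single z.2 1, c z.1 z.2)
  let L := Fintype.linearCombination ℝ A
  let T : Set ((ι → ℝ) × (ι → ℝ) × ℝ) := {a} ×ˢ ({b} ×ˢ Set.Iic K)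
  have hmem : ¬ Disjoint (L '' stdSimplex ℝ (ι × ι)) T := by
    intro hdis
    obtain ⟨F, u, v, hu, huv, hv⟩ := geometric_hahn_banach_compact_closed 
      ((convex_stdSimplex ℝ _).linear_image L)
      ((isCompact_stdSimplex ℝ _).image L.continuous_of_finiteDimensional)
      ((convex_singleton a).prod ((convex_singleton b).prod (convex_Iic K)))
      (isClosed_singleton.prod (isClosed_singleton.prod isClosed_Iic)) hdis
    set φ : ι → ℝ := fun i => F (Pi.single i 1, 0, 0) with hφ
    set ψ : ι → ℝ := fun i => F (0, Pi.single i 1, 0) with hψ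
    set t : ℝ := F (0, 0, 1) with ht
    have hF : ∀ x y s, F (x, y, s) = ∑ i, x i * φ i + ∑ i, y i * ψ i + s * t := by
      intro x y s
      have h1 : (x, y, s) = (∑ i, x i • ((Pi.single i 1 : ι → ℝ), (0 : ι → ℝ), (0 : ℝ))) +
          (∑ i, y i • ((0 : ι → ℝ), (Pi.single i 1 : ι → ℝ), (0 : ℝ))) +
          s • ((0 : ι → ℝ), (0 : ι → ℝ), (1 : ℝ)) := by
        refine Prod.ext ?_ (Prod.ext ?_ ?_)
        · ext i; simp [Prod.fst_sum, Pi.single_apply]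
        · ext i; simp [Prod.fst_sum, Prod.snd_sum, Pi.single_apply]
        · simp [Prod.snd_sum]
      rw [h1]
      simp only [map_add, map_sum, map_smul, hφ, hψ, ht, smul_eq_mul]
    have h1 : ∀ i j, φ i + ψ j + c i j * t < u := by
      intro i j
      have := hu _ ⟨Pi.single (i, j) 1, single_mem_stdSimplex ℝ _, rfl⟩
      simpa [L, A, hF, Pi.single_apply] using this
    have h2 : ∀ s ≤ K, v < ∑ i, a i * φ i + ∑ i, b i * ψ i + s * t := by
      intro s hs
      rw [← hF]
      exact hv _ ⟨rfl, rfl, hs⟩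
    have ht0 : t ≤ 0 := by
      by_contra! hpos
      set Z := ∑ i, a i * φ i + ∑ i, b i * ψ i
      have := h2 (min K ((v - Z) / t)) (min_le_left _ _)
      have h3 : min K ((v - Z) / t) * t ≤ (v - Z) / t * t :=
        mul_le_mul_of_nonneg_right (min_le_right _ _) hpos.le
      rw [div_mul_cancel₀ _ hpos.ne'] at h3
      linarith
    let f : ι → ℝ := fun i => Finset.univ.inf' Finset.univ_nonempty fun j => -t * c i j - ψ j
    have hf1 : ∀ i j, f i - f j ≤ -t * c i j := by
      intro i j
      obtain ⟨k, -, hk⟩ := Finset.exists_mem_eq_inf' Finset.univ_nonempty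
        (fun k => -t * c j k - ψ k)
      have h3 : f i ≤ -t * c i k - ψ k := Finset.inf'_le _ (Finset.mem_univ k)
      have h4 : f j = -t * c j k - ψ k := hk
      have := mul_le_mul_of_nonneg_left (htri i j k) (neg_nonneg.2 ht0)
      linarith
    have hf2 : ∀ i, φ i ≤ f i + u := by
      intro i
      have : φ i - u ≤ f i := by
        refine Finset.le_inf' _ _ fun j _ => ?_
        have := h1 i j
        linarith
      linarith
    have hf3 : ∀ i, ψ i ≤ - f i := by
      intro i
      have : f i ≤ -t * c i i - ψ i := Finset.inf'_le _ (Finset.mem_univ i)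
      rw [hself] at this
      linarith
    have h3 := hK (-t) (by linarith) f hf1
    have h4 := h2 K le_rfl
    have h5 : ∑ i, a i * φ i ≤ ∑ i, a i * f i + u := by
      calc _ ≤ ∑ i, a i * (f i + u) :=
            Finset.sum_le_sum fun i _ => mul_le_mul_of_nonneg_left (hf2 i) (ha i)
        _ = _ := by simp only [mul_add, Finset.sum_add_distrib, ← Finset.sum_mul, hane, one_mul]
    have h6 : ∑ i, b i * ψ i ≤ - ∑ i, b i * f i := by
      calc _ ≤ ∑ i, b i * (- f i) :=
            Finset.sum_le_sum fun i _ => mul_le_mul_of_nonneg_left (hf3 i) (hb i)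
        _ = _ := by simp
    have h7 : ∑ i, f i * (a i - b i) = ∑ i, a i * f i - ∑ i, b i * f i := by
      rw [← Finset.sum_sub_distrib]
      exact Finset.sum_congr rfl fun i _ => by ring
    linarith
  rw [Set.not_disjoint_iff] at hmem
  obtain ⟨q, ⟨w, hw, rfl⟩, hqT⟩ := hmem
  have hL : L w = ∑ z, w z • A z := Fintype.linearCombination_apply ..
  rw [hL] at hqT
  obtain ⟨h1, h2, h3⟩ := hqT
  simp only [Set.mem_singleton_iff, Prod.fst_sum, Prod.snd_sum, Set.mem_Iic] at h1 h2 h3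
  refine ⟨w, hw.1, fun i => ?_, fun j => ?_, by simpa [A] using h3⟩
  · rw [← h1]
    simp [A, Fintype.sum_prod_type, Pi.single_apply, Finset.sum_comm (s := Finset.univ) (t := Finset.univ)]
  · rw [← h2]
    simp [A, Fintype.sum_prod_type, Pi.single_apply]

/-- On a finite family of points, a `τ`-Lipschitz family of values extends to a `τ`-Lipschitz
function. -/
theorem exists_lipschitz_extend_fintype {V ι : Type*} [PseudoMetricSpace V] [Fintype ι]
    [Nonempty ι] (e : ι → V) (f : ι → ℝ) (h : ∀ i j, f i - f j ≤ dist (e i) (e j)) :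
    ∃ g : V → ℝ, LipschitzWith 1 g ∧ ∀ i, g (e i) = f i := by
  refine ⟨fun x => Finset.univ.inf' Finset.univ_nonempty fun i => f i + dist x (e i), ?_, ?_⟩
  · refine LipschitzWith.of_le_add fun x y => ?_
    obtain ⟨k, -, hk⟩ := Finset.exists_mem_eq_inf' Finset.univ_nonempty
      (fun i => f i + dist y (e i))
    rw [hk]
    refine (Finset.inf'_le _ (Finset.mem_univ k)).trans ?_
    linarith [dist_triangle x y (e k)]
  · intro i
    refine le_antisymm ((Finset.inf'_le _ (Finset.mem_univ i)).trans (by simp)) ?_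
    exact Finset.le_inf' _ _ fun j _ => by linarith [h i j]

/-- A bounded set of a proper space admits a measurable finite quantization of any precision. -/
theorem exists_measurable_quantization {V : Type*} [NormedAddCommGroup V] [ProperSpace V]
    [MeasurableSpace V] [BorelSpace V] (r : ℝ) {ε : ℝ} (hε : 0 < ε) :
    ∃ (N : ℕ) (e : Fin (N + 1) → V) (q : V → Fin (N + 1)), Measurable q ∧
      ∀ x, ‖x‖ ≤ r → dist (e (q x)) x ≤ ε := by
  obtain ⟨t, ht⟩ := (isCompact_closedBall (0 : V) r).elim_finite_subcover
    (fun k : ℕ => Metric.ball (TopologicalSpace.denseSeq V k) ε) (fun _ => Metric.isOpen_ball)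
    (fun x _ => by
      obtain ⟨k, hk⟩ := (TopologicalSpace.denseRange_denseSeq V).exists_dist_lt x hε
      exact Set.mem_iUnion.2 ⟨k, hk⟩)
  set e := TopologicalSpace.denseSeq V
  set N := t.sup id
  refine ⟨N, fun i => e i, fun x => ⟨SimpleFunc.nearestPtInd e N x,
    Nat.lt_succ_of_le (SimpleFunc.nearestPtInd_le e N x)⟩, ?_, fun x hx => ?_⟩
  · refine measurable_to_countable' fun i => ?_
    convert! (SimpleFunc.nearestPtInd e N).measurableSet_preimage {(i : ℕ)} using 1
    ext x
    simp [Fin.ext_iff]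
  · obtain ⟨k, hk, hxk⟩ : ∃ k ∈ t, x ∈ Metric.ball (e k) ε := by
      simpa using ht (mem_closedBall_zero_iff.2 hx)
    have h := SimpleFunc.edist_nearestPt_le e x (Finset.le_sup (f := id) hk : k ≤ N)
    rw [edist_dist, edist_dist, ENNReal.ofReal_le_ofReal_iff dist_nonneg] at h
    rw [Metric.mem_ball, dist_comm] at hxk
    exact h.trans hxk.le

/-- Bound of the transport cost of order `p` between measures with bounded image by the dual
`1`-Lipschitz discrepancy. -/
theorem transportCost_le_of_lipschitz_discrepancy {V M : Type*} [NormedAddCommGroup V]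
    [ProperSpace V] [MeasurableSpace V] [BorelSpace V] [MeasurableSpace M] {ψ : M → V}
    (hψ : Measurable ψ) {p : ℝ} (hp : 1 ≤ p) {r : ℝ} (hr : 0 < r) {μ ν : Measure M}
    [IsProbabilityMeasure μ] [IsProbabilityMeasure ν]
    (hμ : ∀ᵐ x ∂μ, ‖ψ x‖ ≤ r) (hν : ∀ᵐ x ∂ν, ‖ψ x‖ ≤ r) {K K' : ℝ} (hKK' : K < K')
    (hK : ∀ f : V → ℝ, LipschitzWith 1 f → ∫ x, f (ψ x) ∂μ - ∫ x, f (ψ x) ∂ν ≤ K) :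
    transportCost (fun x y => ENNReal.ofReal (‖ψ x - ψ y‖ ^ p)) μ ν ≤
      ENNReal.ofReal ((2 * r) ^ (p - 1) * K') := by
  classical
  obtain ⟨ε, hε, hεK⟩ : ∃ ε : ℝ, 0 < ε ∧ K + 4 * ε ≤ K' := ⟨(K' - K) / 4, by linarith, by linarith⟩
  obtain ⟨N, e, q, hq, hqe⟩ := exists_measurable_quantization (V := V) r hε
  have hqψ : Measurable fun x => q (ψ x) := hq.comp hψ
  set a : Fin (N + 1) → ℝ := fun i => μ.real ((fun x => q (ψ x)) ⁻¹' {i}) with ha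
  set b : Fin (N + 1) → ℝ := fun i => ν.real ((fun x => q (ψ x)) ⁻¹' {i}) with hb
  have hsum : ∀ (ρ : Measure M) [IsProbabilityMeasure ρ] (f : Fin (N + 1) → ℝ),
      ∑ i, f i * ρ.real ((fun x => q (ψ x)) ⁻¹' {i}) = ∫ x, f (q (ψ x)) ∂ρ := by
    intro ρ _ f
    have : IsProbabilityMeasure (ρ.map fun x => q (ψ x)) :=
      Measure.isProbabilityMeasure_map hqψ.aemeasurable
    rw [← integral_map (φ := fun x => q (ψ x)) (f := f) hqψ.aemeasurable
      (measurable_of_finite f).aestronglyMeasurable, integral_fintype (Integrable.of_finite)]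
    refine Finset.sum_congr rfl fun i _ => ?_
    rw [map_measureReal_apply hqψ (measurableSet_singleton i), smul_eq_mul, mul_comm]
  have hbdd : ∀ (ρ : Measure M) [IsProbabilityMeasure ρ], (∀ᵐ x ∂ρ, ‖ψ x‖ ≤ r) →
      ∀ g : V → ℝ, LipschitzWith 1 g → Integrable (fun x => g (ψ x)) ρ := by
    intro ρ _ hρ g hg
    refine Integrable.of_bound (hg.continuous.measurable.comp hψ).aestronglyMeasurable
      (‖g 0‖ + r) ?_
    filter_upwards [hρ] with x hx
    have := hg.dist_le_mul (ψ x) 0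
    rw [dist_zero_right, NNReal.coe_one, one_mul, dist_eq_norm] at this
    linarith [norm_le_norm_add_norm_sub' (g (ψ x)) (g 0)]
  have hdual : ∀ f : Fin (N + 1) → ℝ, (∀ i j, f i - f j ≤ dist (e i) (e j)) →
      ∑ i, f i * (a i - b i) ≤ K + 2 * ε := by
    intro f hf
    obtain ⟨g, hg, hge⟩ := exists_lipschitz_extend_fintype e f hf
    have hcomp : ∀ (ρ : Measure M) [IsProbabilityMeasure ρ], (∀ᵐ x ∂ρ, ‖ψ x‖ ≤ r) →
        |∫ x, f (q (ψ x)) ∂ρ - ∫ x, g (ψ x) ∂ρ| ≤ ε := by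
      intro ρ _ hρ
      rw [← integral_sub ?_ (hbdd ρ hρ g hg), ← Real.norm_eq_abs]
      · have := norm_integral_le_of_norm_le_const (μ := ρ)
          (f := fun x => f (q (ψ x)) - g (ψ x)) (C := ε) ?_
        · simpa using this
        · filter_upwards [hρ] with x hx
          rw [← hge, ← dist_eq_norm]
          refine (hg.dist_le_mul _ _).trans ?_
          simpa using hqe _ hx
      · exact Integrable.comp_measurable (Integrable.of_finite) hqψ
    have h1 : ∑ i, f i * (a i - b i) = ∫ x, f (q (ψ x)) ∂μ - ∫ x, f (q (ψ x)) ∂ν := by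
      rw [← hsum, ← hsum, ← Finset.sum_sub_distrib]
      exact Finset.sum_congr rfl fun i _ => mul_sub _ _ _
    have h2 := abs_le.1 (hcomp μ hμ)
    have h3 := abs_le.1 (hcomp ν hν)
    linarith [hK g hg, h2.2, h3.1]
  obtain ⟨γ, hγ0, hγa, hγb, hγc⟩ := exists_coupling_matrix_sum_le a b (fun i j => dist (e i) (e j))
    (fun i => dist_self _) (fun i j k => dist_triangle _ _ _) (K + 2 * ε) (by
      intro τ hτ f hf
      rcases hτ.eq_or_lt with rfl | hτ
      · have hc : ∀ i, f i = f 0 := fun i => le_antisymm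
          (by linarith [hf i 0]) (by linarith [hf 0 i])
        have h1 := hsum μ (fun _ => f 0)
        have h2 := hsum ν (fun _ => f 0)
        rw [zero_mul, Finset.sum_congr rfl fun i _ => by rw [hc i, mul_sub],
          Finset.sum_sub_distrib, h1, h2]
        simp
      · have h1 := hdual (fun i => τ⁻¹ * f i) fun i j => by
          rw [← mul_sub, inv_mul_le_iff₀ hτ]
          exact hf i j
        simp only [mul_assoc] at h1
        rwa [← Finset.mul_sum, inv_mul_le_iff₀ hτ] at h1)
    (fun i => measureReal_nonneg) (fun i => measureReal_nonneg)
    (by simpa using hsum μ fun _ => 1)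
  let Q : Fin (N + 1) → Set M := fun i => (fun x => q (ψ x)) ⁻¹' {i}
  have hQ : ∀ i, MeasurableSet (Q i) := fun i => hqψ (measurableSet_singleton i)
  let Γ : Measure (M × M) := ∑ z : Fin (N + 1) × Fin (N + 1),
    ENNReal.ofReal (γ z) • (ProbabilityTheory.cond μ (Q z.1)).prod (ProbabilityTheory.cond ν (Q z.2))
  have hγ_le_a : ∀ i j, γ (i, j) ≤ a i := fun i j => by
    rw [← hγa i]
    exact Finset.single_le_sum (f := fun j => γ (i, j)) (fun _ _ => hγ0 _) (Finset.mem_univ j)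
  have hγ_le_b : ∀ i j, γ (i, j) ≤ b j := fun i j => by
    rw [← hγb j]
    exact Finset.single_le_sum (f := fun i => γ (i, j)) (fun _ _ => hγ0 _) (Finset.mem_univ i)
  have hfst : Γ.map Prod.fst = μ := by
    have h1 : Γ.map Prod.fst = ∑ i, ∑ j, ENNReal.ofReal (γ (i, j)) •
        ProbabilityTheory.cond μ (Q i) := by
      rw [← Measure.mapₗ_apply_of_measurable measurable_fst, map_sum, Fintype.sum_prod_type]
      refine Finset.sum_congr rfl fun i _ => Finset.sum_congr rfl fun j _ => ?_
      rw [map_smul, Measure.mapₗ_apply_of_measurable measurable_fst, Measure.map_fst_prod]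
      rcases eq_or_ne (ν (Q j)) 0 with h0 | h0
      · have : γ (i, j) ≤ 0 := (hγ_le_b i j).trans ((measureReal_eq_zero_iff (by finiteness)).2 h0).le
        simp [ENNReal.ofReal_of_nonpos this]
      · have := ProbabilityTheory.cond_isProbabilityMeasure h0
        simp
    refine (h1.trans ?_).trans (ProbabilityTheory.sum_meas_smul_cond_fiber hqψ μ)
    refine Finset.sum_congr rfl fun i _ => ?_
    rw [← Finset.sum_smul, ← ENNReal.ofReal_sum_of_nonneg fun _ _ => hγ0 _, hγa]
    simp [ha, measureReal_def, Q]
  have hsnd : Γ.map Prod.snd = ν := by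
    have h1 : Γ.map Prod.snd = ∑ j, ∑ i, ENNReal.ofReal (γ (i, j)) •
        ProbabilityTheory.cond ν (Q j) := by
      rw [← Measure.mapₗ_apply_of_measurable measurable_snd, map_sum, Fintype.sum_prod_type_right]
      refine Finset.sum_congr rfl fun j _ => Finset.sum_congr rfl fun i _ => ?_
      rw [map_smul, Measure.mapₗ_apply_of_measurable measurable_snd, Measure.map_snd_prod]
      rcases eq_or_ne (μ (Q i)) 0 with h0 | h0
      · have : γ (i, j) ≤ 0 := (hγ_le_a i j).trans ((measureReal_eq_zero_iff (by finiteness)).2 h0).le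
        simp [ENNReal.ofReal_of_nonpos this]
      · have := ProbabilityTheory.cond_isProbabilityMeasure h0
        simp
    refine (h1.trans ?_).trans (ProbabilityTheory.sum_meas_smul_cond_fiber hqψ ν)
    refine Finset.sum_congr rfl fun i _ => ?_
    rw [← Finset.sum_smul, ← ENNReal.ofReal_sum_of_nonneg fun _ _ => hγ0 _, hγb]
    simp [hb, measureReal_def, Q]
  have hr' : 0 ≤ (2 * r) ^ (p - 1) := by positivity
  have hcell : ∀ i j, ∫⁻ z, ENNReal.ofReal (‖ψ z.1 - ψ z.2‖ ^ p)
      ∂((ProbabilityTheory.cond μ (Q i)).prod (ProbabilityTheory.cond ν (Q j))) ≤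
      ENNReal.ofReal ((2 * r) ^ (p - 1) * (dist (e i) (e j) + 2 * ε)) := by
    intro i j
    have hx : ∀ᵐ z ∂((ProbabilityTheory.cond μ (Q i)).prod (ProbabilityTheory.cond ν (Q j))),
        z.1 ∈ Q i ∧ ‖ψ z.1‖ ≤ r :=
      Measure.quasiMeasurePreserving_fst.ae ((ProbabilityTheory.ae_cond_mem (hQ i)).and
        (ProbabilityTheory.cond_absolutelyContinuous.ae_le hμ))
    have hy : ∀ᵐ z ∂((ProbabilityTheory.cond μ (Q i)).prod (ProbabilityTheory.cond ν (Q j))),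
        z.2 ∈ Q j ∧ ‖ψ z.2‖ ≤ r :=
      Measure.quasiMeasurePreserving_snd.ae ((ProbabilityTheory.ae_cond_mem (hQ j)).and
        (ProbabilityTheory.cond_absolutelyContinuous.ae_le hν))
    calc _ ≤ ∫⁻ _, ENNReal.ofReal ((2 * r) ^ (p - 1) * (dist (e i) (e j) + 2 * ε))
          ∂((ProbabilityTheory.cond μ (Q i)).prod (ProbabilityTheory.cond ν (Q j))) := by
          refine lintegral_mono_ae ?_
          filter_upwards [hx, hy] with z ⟨hz1, hz1r⟩ ⟨hz2, hz2r⟩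
          refine ENNReal.ofReal_le_ofReal ?_
          have h1 : ‖ψ z.1 - ψ z.2‖ ≤ 2 * r := (norm_sub_le _ _).trans (by linarith)
          have h2 : ‖ψ z.1 - ψ z.2‖ ≤ dist (e i) (e j) + 2 * ε := by
            have h3 := hqe _ hz1r
            have h4 := hqe _ hz2r
            rw [show q (ψ z.1) = i from hz1] at h3
            rw [show q (ψ z.2) = j from hz2] at h4
            rw [← dist_eq_norm]
            have := dist_triangle4 (ψ z.1) (e i) (e j) (ψ z.2)
            rw [dist_comm (ψ z.1) (e i)] at this
            linarith
          calc ‖ψ z.1 - ψ z.2‖ ^ p = ‖ψ z.1 - ψ z.2‖ ^ (p - 1) * ‖ψ z.1 - ψ z.2‖ := by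
                rw [← Real.rpow_add_one' (norm_nonneg _) (by linarith), sub_add_cancel]
            _ ≤ _ := mul_le_mul (Real.rpow_le_rpow (norm_nonneg _) h1 (by linarith)) h2
                (norm_nonneg _) hr'
      _ ≤ _ := by
          rw [lintegral_const]
          refine mul_le_of_le_one_right' ?_
          rw [← Set.univ_prod_univ, Measure.prod_prod]
          exact mul_le_one' prob_le_one prob_le_one
  refine (iInf₂_le Γ ⟨hfst, hsnd⟩).trans ?_
  rw [lintegral_finsetSum_measure]
  simp only [lintegral_smul_measure, smul_eq_mul]
  calc _ ≤ ∑ z : Fin (N + 1) × Fin (N + 1), ENNReal.ofReal (γ z) *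
        ENNReal.ofReal ((2 * r) ^ (p - 1) * (dist (e z.1) (e z.2) + 2 * ε)) :=
        Finset.sum_le_sum fun z _ => mul_le_mul_right (hcell z.1 z.2) _
    _ = ENNReal.ofReal (∑ z : Fin (N + 1) × Fin (N + 1), γ z *
        ((2 * r) ^ (p - 1) * (dist (e z.1) (e z.2) + 2 * ε))) := by
        rw [ENNReal.ofReal_sum_of_nonneg fun z _ => mul_nonneg (hγ0 z) (by positivity)]
        exact Finset.sum_congr rfl fun z _ => (ENNReal.ofReal_mul (hγ0 z)).symm
    _ ≤ _ := by
        refine ENNReal.ofReal_le_ofReal ?_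
        have h1 : ∑ z, γ z = 1 := by
          rw [Fintype.sum_prod_type]
          simp only [hγa]
          simpa using hsum μ fun _ => 1
        have h2 : ∑ z : Fin (N + 1) × Fin (N + 1), γ z *
            ((2 * r) ^ (p - 1) * (dist (e z.1) (e z.2) + 2 * ε)) =
            (2 * r) ^ (p - 1) * (∑ z, γ z * dist (e z.1) (e z.2) + 2 * ε) := by
          calc _ = ∑ z : Fin (N + 1) × Fin (N + 1), ((2 * r) ^ (p - 1) *
                (γ z * dist (e z.1) (e z.2)) + (2 * r) ^ (p - 1) * (2 * ε) * γ z) :=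
                Finset.sum_congr rfl fun z _ => by ring
            _ = _ := by
                rw [Finset.sum_add_distrib, ← Finset.mul_sum, ← Finset.mul_sum, h1]
                ring
        rw [h2]
        exact mul_le_mul_of_nonneg_left (by linarith) hr'

/-- Jensen's inequality for the Lebesgue integral of a power. -/
theorem rpow_lintegral_le_lintegral_rpow {α : Type*} [MeasurableSpace α] {ρ : Measure α}
    [IsProbabilityMeasure ρ] {p : ℝ} (hp : 1 ≤ p) {f : α → ℝ≥0∞} (hf : Measurable f) :
    (∫⁻ x, f x ∂ρ) ^ p ≤ ∫⁻ x, f x ^ p ∂ρ := by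
  have hp0 : 0 < p := by linarith
  have h := eLpNorm'_le_eLpNorm'_of_exponent_le one_pos hp ρ
    hf.stronglyMeasurable.aestronglyMeasurable
  simp only [eLpNorm', enorm_eq_self, ENNReal.rpow_one, div_one] at h
  rwa [one_div, ENNReal.le_rpow_inv_iff hp0] at h

/-- The characteristic functions of two probability measures on the line differ by at most the
frequency times the transport distance. -/
theorem enorm_charFun_sub_le_wpPowReal {p : ℝ} (hp : 1 ≤ p) (μ ν : Measure ℝ)
    [IsProbabilityMeasure μ] [IsProbabilityMeasure ν] (t : ℝ) :
    ‖charFun μ t - charFun ν t‖ₑ ≤ ENNReal.ofReal |t| * wpPowReal p μ ν ^ (1 / p) := by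
  have hp0 : 0 < p := by linarith
  rcases eq_or_ne t 0 with rfl | ht
  · simp
  have ht1 : ENNReal.ofReal |t| ^ p ≠ 0 := by simp [hp0, ht]
  have ht2 : ENNReal.ofReal |t| ^ p ≠ ∞ := by simp [hp0.le]
  rw [← ENNReal.rpow_le_rpow_iff hp0, ENNReal.mul_rpow_of_nonneg _ _ hp0.le,
    ← ENNReal.rpow_mul, one_div_mul_cancel hp0.ne', ENNReal.rpow_one, mul_comm,
    ← ENNReal.div_le_iff ht1 ht2]
  refine le_iInf₂ fun γ hγ => ?_
  obtain ⟨rfl, rfl⟩ := hγ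
  rw [ENNReal.div_le_iff ht1 ht2, mul_comm]
  have : IsProbabilityMeasure γ :=
    Measure.isProbabilityMeasure_of_map Prod.fst
  have hgauss : ∀ f : ℝ × ℝ → ℝ, Measurable f →
      Integrable (fun z => Complex.exp (t * f z * Complex.I)) γ := fun f hf => by
    refine Integrable.of_bound (by fun_prop) 1 (Filter.Eventually.of_forall fun z => ?_)
    rw [← Complex.ofReal_mul, Complex.norm_exp_ofReal_mul_I]
  have h1 : charFun (γ.map Prod.fst) t - charFun (γ.map Prod.snd) t =
      ∫ z, (Complex.exp (t * z.1 * Complex.I) - Complex.exp (t * z.2 * Complex.I)) ∂γ := by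
    rw [charFun_apply_real, charFun_apply_real, integral_map (by fun_prop) (by fun_prop),
      integral_map (by fun_prop) (by fun_prop),
      integral_sub (hgauss _ measurable_fst) (hgauss _ measurable_snd)]
  have h2 : ∀ z : ℝ × ℝ,
      ‖Complex.exp (t * z.1 * Complex.I) - Complex.exp (t * z.2 * Complex.I)‖ₑ ≤
        ENNReal.ofReal |t| * ENNReal.ofReal |z.1 - z.2| := by
    intro z
    have h3 : Complex.exp (t * z.1 * Complex.I) - Complex.exp (t * z.2 * Complex.I) =
        Complex.exp ((t * z.2 : ℝ) * Complex.I) *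
          (Complex.exp (Complex.I * (t * (z.1 - z.2) : ℝ)) - 1) := by
      rw [mul_sub, ← Complex.exp_add, mul_one]
      congr 2 <;> push_cast <;> ring
    rw [← ofReal_norm, ← ENNReal.ofReal_mul (abs_nonneg _), h3, norm_mul,
      Complex.norm_exp_ofReal_mul_I, one_mul, ← abs_mul, ← Real.norm_eq_abs]
    exact ENNReal.ofReal_le_ofReal Real.norm_exp_I_mul_ofReal_sub_one_le
  rw [← ENNReal.rpow_one (ENNReal.ofReal |t|), h1]
  calc _ ≤ (ENNReal.ofReal |t| * ∫⁻ z, ENNReal.ofReal |z.1 - z.2| ∂γ) ^ p := by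
        refine ENNReal.rpow_le_rpow ?_ hp0.le
        rw [← lintegral_const_mul _ (by fun_prop)]
        exact (enorm_integral_le_lintegral_enorm _).trans (lintegral_mono h2)
    _ = ENNReal.ofReal |t| ^ p * (∫⁻ z, ENNReal.ofReal |z.1 - z.2| ∂γ) ^ p :=
        ENNReal.mul_rpow_of_nonneg _ _ hp0.le
    _ ≤ ENNReal.ofReal |t| ^ p * ∫⁻ z, ENNReal.ofReal |z.1 - z.2| ^ p ∂γ :=
        mul_le_mul_right (rpow_lintegral_le_lintegral_rpow hp (by fun_prop)) _
    _ = _ := by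
        simp [ENNReal.ofReal_rpow_of_nonneg, hp0.le]

/-- Integration in polar coordinates for the Lebesgue integral. -/
theorem lintegral_eq_lintegral_toSphere_volumeIoiPow {E : Type*} [NormedAddCommGroup E]
    [NormedSpace ℝ E] [FiniteDimensional ℝ E] [Nontrivial E] [MeasurableSpace E] [BorelSpace E]
    (ρ : Measure E) [ρ.IsAddHaarMeasure] {h : E → ℝ≥0∞} (hh : Measurable h) :
    ∫⁻ x, h x ∂ρ = ∫⁻ v : Metric.sphere (0 : E) 1, ∫⁻ t : Set.Ioi (0 : ℝ), h ((t : ℝ) • (v : E))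
      ∂(Measure.volumeIoiPow (Module.finrank ℝ E - 1)) ∂ρ.toSphere := by
  have hm := ρ.measurePreserving_homeomorphUnitSphereProd
  rw [← lintegral_prod (μ := ρ.toSphere) (ν := Measure.volumeIoiPow (Module.finrank ℝ E - 1))
    (fun z : Metric.sphere (0 : E) 1 × Set.Ioi (0 : ℝ) => h ((z.2 : ℝ) • (z.1 : E)))
    (by fun_prop), ← hm.lintegral_comp (by fun_prop)]
  have h1 : ∀ x : ({0}ᶜ : Set E), h (((homeomorphUnitSphereProd E x).2 : ℝ) •
      ((homeomorphUnitSphereProd E x).1 : E)) = h x := by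
    intro x
    have hx : ‖(x : E)‖ ≠ 0 := norm_ne_zero_iff.2 x.2
    simp [smul_inv_smul₀ hx]
  simp only [h1]
  rw [lintegral_subtype_comap (measurableSet_singleton _).compl, restrict_compl_singleton]

/-- A function bounded by a Gaussian times a power of an angular function has its integral
controlled by the `p`-mean of the angular function. -/
theorem lintegral_le_gaussian_mul_sphere_mean {d : ℕ} (hd : d ≠ 0) {p : ℝ} (hp : 1 ≤ p)
    {h : EuclideanSpace ℝ (Fin d) → ℝ≥0∞} (hh : Measurable h) {G : ℝ → ℝ≥0∞} (hG : Measurable G)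
    (hGfin : ∫⁻ x : EuclideanSpace ℝ (Fin d), G ‖x‖ ≠ ∞)
    (w : Metric.sphere (0 : EuclideanSpace ℝ (Fin d)) 1 → ℝ≥0∞)
    (hw : ∀ (t : ℝ) (v : Metric.sphere (0 : EuclideanSpace ℝ (Fin d)) 1), 0 < t →
      h (t • (v : EuclideanSpace ℝ (Fin d))) ≤ G t * w v ^ (1 / p)) :
    ∫⁻ x, h x ≤ (∫⁻ x : EuclideanSpace ℝ (Fin d), G ‖x‖) *
      (∫⁻ v, w v ∂(sphereUniform d)) ^ (1 / p) := by
  have hp0 : 0 < p := by linarith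
  have : Nonempty (Fin d) := ⟨⟨0, Nat.pos_of_ne_zero hd⟩⟩
  set S := (volume : Measure (EuclideanSpace ℝ (Fin d))).toSphere with hS
  set A := S Set.univ with hA
  have hA0 : A ≠ 0 := Measure.measure_univ_ne_zero.2 (Measure.toSphere_ne_zero _)
  have hA1 : A ≠ ∞ := measure_ne_top _ _
  have hσ : IsProbabilityMeasure (sphereUniform d) := ⟨by
    simp [sphereUniform, ← hS, ← hA, ENNReal.inv_mul_cancel hA0 hA1]⟩
  have hSσ : S = A • sphereUniform d := by
    simp [sphereUniform, ← hS, ← hA, smul_smul, ENNReal.mul_inv_cancel hA0 hA1]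
  set P := Measure.volumeIoiPow (Module.finrank ℝ (EuclideanSpace ℝ (Fin d)) - 1)
  set c := ∫⁻ t : Set.Ioi (0 : ℝ), G t ∂P with hc
  have hcA : ∫⁻ x : EuclideanSpace ℝ (Fin d), G ‖x‖ = A * c := by
    rw [lintegral_eq_lintegral_toSphere_volumeIoiPow volume (by fun_prop), mul_comm]
    have : ∀ (v : Metric.sphere (0 : EuclideanSpace ℝ (Fin d)) 1) (t : Set.Ioi (0 : ℝ)),
        G ‖(t : ℝ) • (v : EuclideanSpace ℝ (Fin d))‖ = G t := fun v t => by
      rw [norm_smul, norm_eq_of_mem_sphere, mul_one, Real.norm_of_nonneg (le_of_lt t.2)]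
    simp only [this]
    rw [lintegral_const]
  have hcfin : c ≠ ∞ := fun h0 => hGfin (by rw [hcA, h0, ENNReal.mul_top hA0])
  set J : Metric.sphere (0 : EuclideanSpace ℝ (Fin d)) 1 → ℝ≥0∞ := fun v =>
    ∫⁻ t : Set.Ioi (0 : ℝ), h ((t : ℝ) • (v : EuclideanSpace ℝ (Fin d))) ∂P with hJ
  have hJm : Measurable J := Measurable.lintegral_prod_right' (f := fun z : Metric.sphere
    (0 : EuclideanSpace ℝ (Fin d)) 1 × Set.Ioi (0 : ℝ) =>
      h ((z.2 : ℝ) • (z.1 : EuclideanSpace ℝ (Fin d)))) (by fun_prop)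
  have hJw : ∀ v, J v ^ p ≤ c ^ p * w v := by
    intro v
    calc J v ^ p ≤ (c * w v ^ (1 / p)) ^ p := by
          refine ENNReal.rpow_le_rpow ?_ hp0.le
          rw [hc, ← lintegral_mul_const _ (by fun_prop)]
          exact lintegral_mono fun t => hw t v t.2
      _ = _ := by
          rw [ENNReal.mul_rpow_of_nonneg _ _ hp0.le, ← ENNReal.rpow_mul,
            one_div_mul_cancel hp0.ne', ENNReal.rpow_one]
  rw [lintegral_eq_lintegral_toSphere_volumeIoiPow volume hh, hcA, ← hS, hSσ,
    lintegral_smul_measure, smul_eq_mul, mul_assoc]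
  refine mul_le_mul_right ?_ _
  rw [← ENNReal.rpow_le_rpow_iff hp0, ENNReal.mul_rpow_of_nonneg _ _ hp0.le, ← ENNReal.rpow_mul,
    one_div_mul_cancel hp0.ne', ENNReal.rpow_one]
  calc _ ≤ ∫⁻ v, J v ^ p ∂(sphereUniform d) := rpow_lintegral_le_lintegral_rpow hp hJm
    _ ≤ ∫⁻ v, c ^ p * w v ∂(sphereUniform d) := lintegral_mono hJw
    _ = _ := lintegral_const_mul' _ _ (ENNReal.rpow_ne_top_of_nonneg hp0.le hcfin)

/-- A `1`-Lipschitz function vanishing at the origin can be cut off outside a ball while remaining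
`1`-Lipschitz. -/
theorem LipschitzWith.exists_cutoff {V : Type*} [NormedAddCommGroup V] {f : V → ℝ}
    (hf : LipschitzWith 1 f) (hf0 : f 0 = 0) (r : ℝ) :
    ∃ g : V → ℝ, LipschitzWith 1 g ∧ (∀ x, ‖x‖ ≤ r → g x = f x) ∧ ∀ x, 2 * r ≤ ‖x‖ → g x = 0 := by
  have hu : LipschitzWith 1 fun x : V => max (2 * r - ‖x‖) 0 := by
    refine LipschitzWith.max_const (LipschitzWith.of_le_add fun x y => ?_) 0
    rw [dist_eq_norm]
    have := norm_sub_norm_le y x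
    rw [norm_sub_rev] at this
    linarith
  have hg : LipschitzWith 1 fun x : V =>
      max (-max (2 * r - ‖x‖) 0) (min (f x) (max (2 * r - ‖x‖) 0)) := by
    simpa using hu.neg.max (hf.min hu)
  refine ⟨_, hg, fun x hx => ?_, fun x hx => ?_⟩
  · have h1 := hf.dist_le_mul x 0
    rw [hf0, dist_zero_right, dist_zero_right, NNReal.coe_one, one_mul, Real.norm_eq_abs] at h1
    obtain ⟨h2, h3⟩ := abs_le.1 h1
    have h4 : max (2 * r - ‖x‖) 0 = 2 * r - ‖x‖ := max_eq_left (by linarith [norm_nonneg x])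
    simp only [h4]
    rw [min_eq_left (by linarith), max_eq_right (by linarith)]
  · have h4 : max (2 * r - ‖x‖) 0 = 0 := max_eq_right (by linarith)
    simp only [h4]
    simp

section FourierSmoothing

open scoped FourierTransform

variable {V : Type*} [NormedAddCommGroup V] [InnerProductSpace ℝ V] [FiniteDimensional ℝ V]
  [MeasurableSpace V] [BorelSpace V]

/-- Decay of the Fourier transform of a compactly supported `1`-Lipschitz function. -/
theorem norm_fourier_mul_norm_le_of_lipschitz {g : V → ℂ} (hg : LipschitzWith 1 g)
    (hgi : Integrable g) {R : ℝ} (hR : ∀ x, R ≤ ‖x‖ → g x = 0) (ξ : V) :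
    ‖𝓕 g ξ‖ * ‖ξ‖ ≤ (volume : Measure V).real (Metric.closedBall 0 R) / 2 := by
  rcases eq_or_ne ξ 0 with rfl | hξ
  · simp only [norm_zero, mul_zero]
    positivity
  have hξ' : 0 < ‖ξ‖ := norm_pos_iff.2 hξ
  set h : V := (1 / (2 * ‖ξ‖ ^ 2) : ℝ) • ξ with hh
  have hn : ‖h‖ = 1 / (2 * ‖ξ‖) := by
    rw [hh, norm_smul, Real.norm_of_nonneg (by positivity)]
    field_simp
  set B : Set V := Metric.closedBall 0 R
  set B' : Set V := (fun x => x + h) ⁻¹' B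
  have hB : MeasurableSet B := measurableSet_closedBall
  have hB' : MeasurableSet B' := (measurable_add_const h) hB
  have hBfin : volume B ≠ ∞ := measure_closedBall_lt_top.ne
  have hBB' : volume B' = volume B := measure_preimage_add_right _ _ _
  have hnot : ∀ x, x ∉ B → g x = 0 := fun x hx => hR x (by
    simp only [B, mem_closedBall_zero_iff, not_le] at hx
    exact hx.le)
  have hpt : ∀ v, ‖𝐞 (-⟪v, ξ⟫) • (g v - g (v + h))‖ ≤
      B.indicator (fun _ => ‖h‖) v + B'.indicator (fun _ => ‖h‖) v := by
    intro v
    rw [Circle.norm_smul]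
    have h0 : ∀ s : Set V, 0 ≤ s.indicator (fun _ => ‖h‖) v := fun s =>
      Set.indicator_nonneg (fun _ _ => norm_nonneg _) _
    have hl : ‖g v - g (v + h)‖ ≤ ‖h‖ := by
      have := hg.dist_le_mul v (v + h)
      simpa [dist_eq_norm] using this
    by_cases h1 : v ∈ B
    · rw [Set.indicator_of_mem h1]
      linarith [h0 B']
    by_cases h2 : v ∈ B'
    · rw [Set.indicator_of_mem h2]
      linarith [h0 B]
    · rw [hnot v h1, hnot (v + h) h2]
      simpa using add_nonneg (h0 B) (h0 B')
  have hi1 : Integrable (B.indicator fun _ : V => ‖h‖) :=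
    (integrable_indicator_iff hB).2 (integrableOn_const hBfin)
  have hi2 : Integrable (B'.indicator fun _ : V => ‖h‖) :=
    (integrable_indicator_iff hB').2 (integrableOn_const (hBB' ▸ hBfin))
  have hmain : ‖𝓕 g ξ‖ ≤ (volume : Measure V).real B * ‖h‖ := by
    rw [Real.fourier_eq, fourierIntegral_eq_half_sub_half_period_translate hξ hgi, norm_smul]
    have h1 := norm_integral_le_of_norm_le (hi1.add hi2) (Filter.Eventually.of_forall hpt)
    simp only [Pi.add_apply] at h1
    rw [integral_add hi1 hi2, integral_indicator_const _ hB, integral_indicator_const _ hB',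
      measureReal_def volume B', hBB', ← measureReal_def, smul_eq_mul] at h1
    have h2 : ‖(1 / 2 : ℂ)‖ = 1 / 2 := by simp
    rw [h2]
    linarith
  calc ‖𝓕 g ξ‖ * ‖ξ‖ ≤ (volume : Measure V).real B * ‖h‖ * ‖ξ‖ :=
        mul_le_mul_of_nonneg_right hmain hξ'.le
    _ = _ := by
        rw [hn]
        field_simp

/-- Fourier representation of the Gaussian regularization of an integrable function. -/
theorem integral_gaussian_mul_fourier_eq {g : V → ℂ} (hgi : Integrable g) {l : ℝ} (hl : 0 < l)
    (x : V) :
    ∫ ξ, Complex.exp (-((l ^ 2 : ℝ) : ℂ) * ‖ξ‖ ^ 2 + 2 * Real.pi * Complex.I * ⟪x, ξ⟫) * 𝓕 g ξ =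
      ∫ z : V, ((Real.pi ^ (Module.finrank ℝ V / 2 : ℝ) * Real.exp (-Real.pi ^ 2 * ‖z‖ ^ 2) : ℝ) : ℂ)
        * g (x + l • z) := by
  have hl' : (l : ℂ) ≠ 0 := Complex.ofReal_ne_zero.2 hl.ne'
  have hb : 0 < (((l ^ 2 : ℝ) : ℂ)).re := by
    rw [Complex.ofReal_re]
    positivity
  have hGi : Integrable fun ξ : V => Complex.exp (-((l ^ 2 : ℝ) : ℂ) * ‖ξ‖ ^ 2 +
      2 * Real.pi * Complex.I * ⟪x, ξ⟫) :=
    GaussianFourier.integrable_cexp_neg_mul_sq_norm_add hb _ x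
  have h1 := VectorFourier.integral_fourierIntegral_smul_eq_flip (L := innerₗ V)
    Real.continuous_fourierChar continuous_inner hGi hgi
  rw [flip_innerₗ] at h1
  change _ = ∫ ξ, _ • 𝓕 g ξ at h1
  simp only [smul_eq_mul] at h1
  rw [← h1]
  change ∫ ξ, 𝓕 (fun ξ : V => Complex.exp (-((l ^ 2 : ℝ) : ℂ) * ‖ξ‖ ^ 2 +
      2 * Real.pi * Complex.I * ⟪x, ξ⟫)) ξ * g ξ = _
  simp only [fourier_gaussian_innerProductSpace' hb]
  rw [← integral_add_left_eq_self _ x]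
  have h2 := Measure.integral_comp_smul_of_nonneg (volume : Measure V) (fun y : V =>
    (((Real.pi : ℂ) / ((l ^ 2 : ℝ) : ℂ)) ^ (Module.finrank ℝ V / 2 : ℂ) *
      Complex.exp (-Real.pi ^ 2 * ‖x - (x + y)‖ ^ 2 / ((l ^ 2 : ℝ) : ℂ)) * g (x + y))) l (hR := hl.le)
  rw [eq_comm, inv_smul_eq_iff₀ (by positivity)] at h2
  rw [h2, ← integral_smul]
  refine integral_congr_ae (Filter.Eventually.of_forall fun z => ?_)
  have h3 : ((Real.pi : ℂ) / ((l ^ 2 : ℝ) : ℂ)) ^ (Module.finrank ℝ V / 2 : ℂ) =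
      ((Real.pi ^ (Module.finrank ℝ V / 2 : ℝ) / l ^ Module.finrank ℝ V : ℝ) : ℂ) := by
    rw [← Complex.ofReal_div]
    have : (Module.finrank ℝ V / 2 : ℂ) = ((Module.finrank ℝ V / 2 : ℝ) : ℂ) := by push_cast; rfl
    rw [this, ← Complex.ofReal_cpow (by positivity), Real.div_rpow Real.pi_pos.le (by positivity),
      ← Real.rpow_natCast l 2, ← Real.rpow_mul hl.le, Nat.cast_ofNat,
      mul_div_cancel₀ _ two_ne_zero, Real.rpow_natCast]
  have h4 : (-Real.pi ^ 2 * ‖x - (x + l • z)‖ ^ 2 / ((l ^ 2 : ℝ) : ℂ) : ℂ) =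
      ((-Real.pi ^ 2 * ‖z‖ ^ 2 : ℝ) : ℂ) := by
    rw [sub_add_cancel_left, norm_neg, norm_smul, Real.norm_of_nonneg hl.le]
    push_cast
    field_simp
  simp only [h3, h4, ← Complex.ofReal_exp, Complex.real_smul]
  push_cast
  field_simp

/-- Gaussian regularization at scale `l` moves a `1`-Lipschitz function by `O(l)`. -/
theorem norm_integral_gaussian_mul_fourier_sub_le {g : V → ℂ} (hg : LipschitzWith 1 g)
    (hgi : Integrable g) {l : ℝ} (hl : 0 < l) (x : V) :
    ‖(∫ ξ, Complex.exp (-((l ^ 2 : ℝ) : ℂ) * ‖ξ‖ ^ 2 + 2 * Real.pi * Complex.I * ⟪x, ξ⟫) * 𝓕 g ξ)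
        - g x‖ ≤
      l * ∫ z : V, Real.pi ^ (Module.finrank ℝ V / 2 : ℝ) *
        Real.exp (-(Real.pi ^ 2 - 1) * ‖z‖ ^ 2) := by
  have hpi : 1 < Real.pi ^ 2 := by nlinarith [Real.pi_gt_three]
  have hgauss : ∀ b : ℝ, 0 < b → Integrable fun z : V =>
      Real.pi ^ (Module.finrank ℝ V / 2 : ℝ) * Real.exp (-b * ‖z‖ ^ 2) := by
    intro b hb
    refine Integrable.const_mul ?_ _
    have := (GaussianFourier.integrable_cexp_neg_mul_sq_norm_add (V := V) (b := (b : ℂ))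
      (by simpa using hb) 0 0).norm
    refine this.congr (Filter.Eventually.of_forall fun z => ?_)
    simp [Complex.norm_exp, ← Complex.ofReal_pow]
  set k : V → ℝ := fun z => Real.pi ^ (Module.finrank ℝ V / 2 : ℝ) *
    Real.exp (-Real.pi ^ 2 * ‖z‖ ^ 2) with hk
  have hki : Integrable k := hgauss (Real.pi ^ 2) (by positivity)
  have hk1 : ∫ z, k z = 1 := by
    rw [hk, integral_const_mul, GaussianFourier.integral_rexp_neg_mul_sq_norm (by positivity),
      ← Real.mul_rpow (by positivity) (by positivity)]
    have : Real.pi * (Real.pi / Real.pi ^ 2) = 1 := by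
      field_simp
    rw [this, Real.one_rpow]
  have hgx : g x = ∫ z : V, (k z : ℂ) * g x := by
    rw [integral_mul_const, integral_complex_ofReal, hk1]
    simp
  have hbound : ∀ z : V, ‖(k z : ℂ) * (g (x + l • z) - g x)‖ ≤
      l * (Real.pi ^ (Module.finrank ℝ V / 2 : ℝ) *
        Real.exp (-(Real.pi ^ 2 - 1) * ‖z‖ ^ 2)) := by
    intro z
    have h1 : ‖g (x + l • z) - g x‖ ≤ l * Real.exp (‖z‖ ^ 2) := by
      have h2 := hg.dist_le_mul (x + l • z) x
      rw [dist_eq_norm, dist_eq_norm, add_sub_cancel_left, norm_smul, Real.norm_of_nonneg hl.le,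
        NNReal.coe_one, one_mul] at h2
      refine h2.trans (mul_le_mul_of_nonneg_left ?_ hl.le)
      nlinarith [Real.add_one_le_exp (‖z‖ ^ 2), sq_nonneg (‖z‖ - 1)]
    have hk0 : 0 ≤ k z := by positivity
    rw [norm_mul, Complex.norm_real, Real.norm_of_nonneg hk0]
    refine (mul_le_mul_of_nonneg_left h1 hk0).trans_eq ?_
    have : Real.exp (-(Real.pi ^ 2 - 1) * ‖z‖ ^ 2) =
        Real.exp (-Real.pi ^ 2 * ‖z‖ ^ 2) * Real.exp (‖z‖ ^ 2) := by
      rw [← Real.exp_add]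
      ring_nf
    rw [this, hk]
    ring
  have hgauss_l := (hgauss (Real.pi ^ 2 - 1) (by linarith)).const_mul l
  have hdiff : Integrable fun z : V => (k z : ℂ) * (g (x + l • z) - g x) := by
    refine hgauss_l.mono' (Continuous.aestronglyMeasurable ?_) (Filter.Eventually.of_forall hbound)
    have := hg.continuous
    fun_prop
  have hcx : Integrable fun z : V => (k z : ℂ) * g x := hki.ofReal.mul_const _
  have hsum : Integrable fun z : V => (k z : ℂ) * g (x + l • z) := by
    refine (hdiff.add hcx).congr (Filter.Eventually.of_forall fun z => ?_)
    simp only [Pi.add_apply]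
    ring
  rw [integral_gaussian_mul_fourier_eq hgi hl, ← integral_const_mul]
  have h5 : (∫ z : V, (k z : ℂ) * g (x + l • z)) - g x =
      ∫ z : V, (k z : ℂ) * (g (x + l • z) - g x) := by
    conv_lhs => rw [hgx]
    rw [← integral_sub hsum hcx]
    simp only [mul_sub]
  rw [h5]
  exact norm_integral_le_of_norm_le hgauss_l (Filter.Eventually.of_forall hbound)

/-- The discrepancy of two probability measures on a compactly supported `1`-Lipschitz function is
controlled by their characteristic functions, up to an error `O(l)`. -/
theorem ofReal_integral_sub_le_lintegral_charFun {μ ν : Measure V} [IsProbabilityMeasure μ]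
    [IsProbabilityMeasure ν] {g : V → ℝ} (hg : LipschitzWith 1 g) (hgi : Integrable g) {l : ℝ}
    (hl : 0 < l) (hμ : Integrable g μ) (hν : Integrable g ν) :
    ENNReal.ofReal (∫ x, g x ∂μ - ∫ x, g x ∂ν) ≤
      ENNReal.ofReal (2 * (l * ∫ z : V, Real.pi ^ (Module.finrank ℝ V / 2 : ℝ) *
        Real.exp (-(Real.pi ^ 2 - 1) * ‖z‖ ^ 2))) +
      ∫⁻ ξ : V, ‖Complex.exp (-((l ^ 2 : ℝ) : ℂ) * ‖ξ‖ ^ 2) * 𝓕 (fun x => (g x : ℂ)) ξ *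
        (charFun μ ((2 * Real.pi) • ξ) - charFun ν ((2 * Real.pi) • ξ))‖ₑ := by
  set m : ℝ := ∫ z : V, Real.pi ^ (Module.finrank ℝ V / 2 : ℝ) *
    Real.exp (-(Real.pi ^ 2 - 1) * ‖z‖ ^ 2)
  set F : V → ℂ := 𝓕 (fun x => (g x : ℂ)) with hF
  have hgi' : Integrable fun x => (g x : ℂ) := hgi.ofReal
  have hg' : LipschitzWith 1 fun x => (g x : ℂ) := by
    refine LipschitzWith.of_dist_le_mul fun x y => ?_
    have := hg.dist_le_mul x y
    rwa [dist_eq_norm, ← Complex.ofReal_sub, Complex.norm_real, ← dist_eq_norm]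
  have hFc : Continuous F :=
    VectorFourier.fourierIntegral_continuous Real.continuous_fourierChar
      (L := innerₗ V) continuous_inner hgi'
  have hFb : ∀ ξ, ‖F ξ‖ ≤ ∫ x, ‖(g x : ℂ)‖ := fun ξ =>
    VectorFourier.norm_fourierIntegral_le_integral_norm _ _ _ _ _
  have hb : 0 < (((l ^ 2 : ℝ) : ℂ)).re := by
    rw [Complex.ofReal_re]
    positivity
  have hγ : Integrable fun ξ : V => Complex.exp (-((l ^ 2 : ℝ) : ℂ) * ‖ξ‖ ^ 2) := by
    simpa using GaussianFourier.integrable_cexp_neg_mul_sq_norm_add (V := V) hb 0 0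
  set A : V → ℂ := fun ξ => Complex.exp (-((l ^ 2 : ℝ) : ℂ) * ‖ξ‖ ^ 2) * F ξ with hA
  have hAi : Integrable A := hγ.mul_bdd hFc.aestronglyMeasurable (Filter.Eventually.of_forall hFb)
  set S : V → ℂ := fun x => ∫ ξ, Complex.exp (-((l ^ 2 : ℝ) : ℂ) * ‖ξ‖ ^ 2 +
    2 * Real.pi * Complex.I * ⟪x, ξ⟫) * F ξ with hS
  have hker : ∀ x ξ : V, Complex.exp (-((l ^ 2 : ℝ) : ℂ) * ‖ξ‖ ^ 2 +
      2 * Real.pi * Complex.I * ⟪x, ξ⟫) * F ξ =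
      A ξ * Complex.exp (⟪x, (2 * Real.pi) • ξ⟫ * Complex.I) := by
    intro x ξ
    rw [Complex.exp_add, hA, inner_smul_right]
    push_cast
    ring_nf
  have hprod : ∀ (ρ : Measure V) [IsProbabilityMeasure ρ], Integrable (fun z : V × V =>
      Complex.exp (-((l ^ 2 : ℝ) : ℂ) * ‖z.2‖ ^ 2 +
        2 * Real.pi * Complex.I * ⟪z.1, z.2⟫) * F z.2) (ρ.prod volume) := by
    intro ρ _
    refine (hAi.comp_snd ρ).mono (Continuous.aestronglyMeasurable (by fun_prop))
      (Filter.Eventually.of_forall fun z => ?_)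
    rw [hker, norm_mul, Complex.norm_exp_ofReal_mul_I, mul_one]
  have hSi : ∀ (ρ : Measure V) [IsProbabilityMeasure ρ], Integrable S ρ := fun ρ _ =>
    (hprod ρ).integral_prod_left
  have hchar : ∀ (ρ : Measure V) [IsProbabilityMeasure ρ],
      ∫ x, S x ∂ρ = ∫ ξ, A ξ * charFun ρ ((2 * Real.pi) • ξ) := by
    intro ρ _
    rw [hS, integral_integral_swap (hprod ρ)]
    refine integral_congr_ae (Filter.Eventually.of_forall fun ξ => ?_)
    simp only [hker, charFun_apply]
    rw [integral_const_mul]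
  have hchari : ∀ (ρ : Measure V) [IsProbabilityMeasure ρ],
      Integrable fun ξ => A ξ * charFun ρ ((2 * Real.pi) • ξ) := fun ρ _ =>
    hAi.mul_bdd (c := 1) ((measurable_charFun.comp (measurable_const_smul _)).aestronglyMeasurable)
      (Filter.Eventually.of_forall fun ξ => norm_charFun_le_one _)
  have happrox : ∀ (ρ : Measure V) [IsProbabilityMeasure ρ], Integrable g ρ →
      ‖∫ x, S x ∂ρ - ((∫ x, g x ∂ρ : ℝ) : ℂ)‖ ≤ l * m := by
    intro ρ _ hρ
    have hρ' : Integrable (fun x => (g x : ℂ)) ρ := hρ.ofReal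
    rw [← integral_complex_ofReal, ← integral_sub (hSi ρ) hρ']
    refine (norm_integral_le_of_norm_le_const (C := l * m) (Filter.Eventually.of_forall fun x =>
      norm_integral_gaussian_mul_fourier_sub_le hg' hgi' hl x)).trans_eq ?_
    simp
  have hdiff : ∫ x, S x ∂μ - ∫ x, S x ∂ν = ∫ ξ, A ξ *
      (charFun μ ((2 * Real.pi) • ξ) - charFun ν ((2 * Real.pi) • ξ)) := by
    rw [hchar μ, hchar ν, ← integral_sub (hchari μ) (hchari ν)]
    simp only [mul_sub]
  have h1 := happrox μ hμ
  have h2 := happrox ν hν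
  have h3 : ∫ x, g x ∂μ - ∫ x, g x ∂ν ≤ 2 * (l * m) + ‖∫ x, S x ∂μ - ∫ x, S x ∂ν‖ := by
    have h4 : ((∫ x, g x ∂μ - ∫ x, g x ∂ν : ℝ) : ℂ) =
        (∫ x, S x ∂μ - ∫ x, S x ∂ν) - (∫ x, S x ∂μ - ((∫ x, g x ∂μ : ℝ) : ℂ)) +
          (∫ x, S x ∂ν - ((∫ x, g x ∂ν : ℝ) : ℂ)) := by
      push_cast
      ring
    have h5 := (le_abs_self _).trans_eq (Complex.norm_real (∫ x, g x ∂μ - ∫ x, g x ∂ν)).symm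
    rw [h4] at h5
    have h6 := norm_add_le ((∫ x, S x ∂μ - ∫ x, S x ∂ν) -
      (∫ x, S x ∂μ - ((∫ x, g x ∂μ : ℝ) : ℂ))) (∫ x, S x ∂ν - ((∫ x, g x ∂ν : ℝ) : ℂ))
    have h7 := norm_sub_le (∫ x, S x ∂μ - ∫ x, S x ∂ν)
      (∫ x, S x ∂μ - ((∫ x, g x ∂μ : ℝ) : ℂ))
    linarith
  refine (ENNReal.ofReal_le_ofReal h3).trans (ENNReal.ofReal_add_le.trans ?_)
  gcongr
  rw [ofReal_norm, hdiff]
  exact enorm_integral_le_lintegral_enorm _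

end FourierSmoothing

/-- The discrepancy of two probability measures supported in a ball on `1`-Lipschitz functions is
controlled by the spherical mean of the transport costs of their one-dimensional projections. -/
theorem exists_ofReal_integral_sub_le_sliced {d : ℕ} (hd : d ≠ 0) {p : ℝ} (hp : 1 ≤ p) (r : ℝ) :
    ∃ C : ℝ, 0 ≤ C ∧ ∀ (μ ν : Measure (EuclideanSpace ℝ (Fin d))), IsProbabilityMeasure μ →
      IsProbabilityMeasure ν → (∀ᵐ x ∂μ, ‖x‖ ≤ r) → (∀ᵐ x ∂ν, ‖x‖ ≤ r) →
      ∀ f : EuclideanSpace ℝ (Fin d) → ℝ, LipschitzWith 1 f → ∀ l : ℝ, 0 < l →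
        ENNReal.ofReal (∫ x, f x ∂μ - ∫ x, f x ∂ν) ≤ ENNReal.ofReal (C * l) +
          ENNReal.ofReal (C * (l ^ d)⁻¹) *
            (∫⁻ v : Metric.sphere (0 : EuclideanSpace ℝ (Fin d)) 1,
              wpPowReal p (μ.map fun x => ⟪x, (v : EuclideanSpace ℝ (Fin d))⟫)
                (ν.map fun x => ⟪x, (v : EuclideanSpace ℝ (Fin d))⟫) ∂(sphereUniform d)) ^
              (1 / p) := by
  set E := EuclideanSpace ℝ (Fin d)
  set m : ℝ := ∫ z : E, Real.pi ^ (Module.finrank ℝ E / 2 : ℝ) *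
    Real.exp (-(Real.pi ^ 2 - 1) * ‖z‖ ^ 2) with hm
  have hm0 : 0 ≤ m := integral_nonneg fun z => by positivity
  set Vol : ℝ := (volume : Measure E).real (Metric.closedBall 0 (2 * r)) with hVol
  have hVol0 : 0 ≤ Vol := measureReal_nonneg
  set C₂ : ℝ := Real.pi * Vol * Real.pi ^ ((d : ℝ) / 2) with hC₂
  have hC₂0 : 0 ≤ C₂ := by positivity
  refine ⟨2 * m + C₂, by positivity, fun μ ν hμp hνp hμ hν f hf l hl => ?_⟩
  have hf0 : LipschitzWith 1 fun x => f x - f 0 := by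
    refine LipschitzWith.of_dist_le_mul fun x y => ?_
    rw [dist_sub_right]
    exact hf.dist_le_mul x y
  obtain ⟨g, hg, hgf, hgz⟩ := hf0.exists_cutoff (sub_self _) r
  have hgcs : HasCompactSupport g := by
    refine HasCompactSupport.intro (isCompact_closedBall (0 : E) (2 * r)) fun x hx => hgz x ?_
    simp only [mem_closedBall_zero_iff, not_le] at hx
    exact hx.le
  have hgint : ∀ (ρ : Measure E) [IsFiniteMeasureOnCompacts ρ], Integrable g ρ := fun ρ _ =>
    hg.continuous.integrable_of_hasCompactSupport hgcs
  have hfg : ∀ (ρ : Measure E), IsProbabilityMeasure ρ → (∀ᵐ x ∂ρ, ‖x‖ ≤ r) →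
      ∫ x, f x ∂ρ = ∫ x, g x ∂ρ + f 0 := by
    intro ρ _ hρ
    have h1 : ∫ x, f x ∂ρ = ∫ x, (g x + f 0) ∂ρ := by
      refine integral_congr_ae (hρ.mono fun x hx => ?_)
      simp only [hgf x hx, sub_add_cancel]
    rw [h1, integral_add (hgint ρ) (integrable_const _), integral_const,
      probReal_univ, one_smul]
  have hdisc : ∫ x, f x ∂μ - ∫ x, f x ∂ν = ∫ x, g x ∂μ - ∫ x, g x ∂ν := by
    rw [hfg μ hμp hμ, hfg ν hνp hν]
    ring
  rw [hdisc]
  refine (ofReal_integral_sub_le_lintegral_charFun hg (hgint volume) hl (hgint μ)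
    (hgint ν)).trans ?_
  have hg' : LipschitzWith 1 fun x => (g x : ℂ) := by
    refine LipschitzWith.of_dist_le_mul fun x y => ?_
    have := hg.dist_le_mul x y
    rwa [dist_eq_norm, ← Complex.ofReal_sub, Complex.norm_real, ← dist_eq_norm]
  have hgi' : Integrable fun x => (g x : ℂ) := (hgint volume).ofReal
  set F : E → ℂ := FourierTransform.fourier (fun x => (g x : ℂ)) with hF
  have hFc : Continuous F :=
    VectorFourier.fourierIntegral_continuous Real.continuous_fourierChar
      (L := innerₗ E) continuous_inner hgi'
  have hFb : ∀ ξ, ‖F ξ‖ * ‖ξ‖ ≤ Vol / 2 := fun ξ =>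
    norm_fourier_mul_norm_le_of_lipschitz hg' hgi' (fun x hx => by simp [hgz x hx]) ξ
  set G : ℝ → ℝ≥0∞ := fun t => ENNReal.ofReal (Real.pi * Vol * Real.exp (-(l ^ 2) * t ^ 2)) with hG
  have hGm : Measurable G := by fun_prop
  have hGint : ∫⁻ x : E, G ‖x‖ = ENNReal.ofReal (C₂ * (l ^ d)⁻¹) := by
    have hgauss : Integrable fun z : E => Real.exp (-(l ^ 2) * ‖z‖ ^ 2) := by
      have := (GaussianFourier.integrable_cexp_neg_mul_sq_norm_add (V := E) (b := ((l ^ 2 : ℝ) : ℂ))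
        (by rw [Complex.ofReal_re]; positivity) 0 0).norm
      refine this.congr (Filter.Eventually.of_forall fun z => ?_)
      simp [Complex.norm_exp, ← Complex.ofReal_pow]
    rw [← ofReal_integral_eq_lintegral_ofReal (hgauss.const_mul _)
      (Filter.Eventually.of_forall fun z => by positivity), integral_const_mul,
      GaussianFourier.integral_rexp_neg_mul_sq_norm (by positivity), finrank_euclideanSpace_fin,
      Real.div_rpow Real.pi_pos.le (by positivity), ← Real.rpow_natCast l 2,
      ← Real.rpow_mul hl.le, Nat.cast_ofNat, mul_div_cancel₀ _ two_ne_zero, Real.rpow_natCast,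
      hC₂]
    congr 1
    ring
  have hchar : ∀ (ρ : Measure E) (t : ℝ) (v : E),
      charFun ρ ((2 * Real.pi) • t • v) = charFun (ρ.map fun x => ⟪x, v⟫) (2 * Real.pi * t) := by
    intro ρ t v
    rw [charFun_apply, charFun_apply_real, integral_map (by fun_prop) (by fun_prop)]
    refine integral_congr_ae (Filter.Eventually.of_forall fun x => ?_)
    simp only [inner_smul_right]
    push_cast
    ring_nf
  have hmeas : ∀ (ρ : Measure E) [IsProbabilityMeasure ρ],
      Measurable fun ξ : E => charFun ρ ((2 * Real.pi) • ξ) := fun ρ _ =>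
    measurable_charFun.comp (measurable_const_smul _)
  have hD := lintegral_le_gaussian_mul_sphere_mean hd hp
    (h := fun ξ : E => ‖Complex.exp (-((l ^ 2 : ℝ) : ℂ) * ‖ξ‖ ^ 2) * F ξ *
        (charFun μ ((2 * Real.pi) • ξ) - charFun ν ((2 * Real.pi) • ξ))‖ₑ)
    (((Continuous.measurable (by fun_prop)).mul
      ((hmeas μ).sub (hmeas ν))).enorm) hGm (hGint ▸ ENNReal.ofReal_ne_top)
    (fun v => wpPowReal p (μ.map fun x => ⟪x, (v : E)⟫) (ν.map fun x => ⟪x, (v : E)⟫)) (by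
      intro t v ht
      have hv : ‖(v : E)‖ = 1 := norm_eq_of_mem_sphere v
      have : IsProbabilityMeasure (μ.map fun x => ⟪x, (v : E)⟫) :=
        Measure.isProbabilityMeasure_map (by fun_prop)
      have : IsProbabilityMeasure (ν.map fun x => ⟪x, (v : E)⟫) :=
        Measure.isProbabilityMeasure_map (by fun_prop)
      have h1 := enorm_charFun_sub_le_wpPowReal hp (μ.map fun x => ⟪x, (v : E)⟫)
        (ν.map fun x => ⟪x, (v : E)⟫) (2 * Real.pi * t)
      have htv : ‖t • (v : E)‖ = t := by
        rw [norm_smul, hv, mul_one, Real.norm_of_nonneg ht.le]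
      have h2 : ‖Complex.exp (-((l ^ 2 : ℝ) : ℂ) * ‖t • (v : E)‖ ^ 2) * F (t • (v : E))‖ *
          |2 * Real.pi * t| ≤ Real.pi * Vol * Real.exp (-(l ^ 2) * t ^ 2) := by
        have h3 := hFb (t • (v : E))
        rw [htv] at h3
        have h4 : ‖Complex.exp (-((l ^ 2 : ℝ) : ℂ) * ‖t • (v : E)‖ ^ 2)‖ =
            Real.exp (-(l ^ 2) * t ^ 2) := by
          rw [htv, ← Complex.ofReal_neg, ← Complex.ofReal_pow, ← Complex.ofReal_mul,
            ← Complex.ofReal_exp, Complex.norm_real, Real.norm_of_nonneg (Real.exp_pos _).le]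
        rw [norm_mul, h4, abs_of_nonneg (by positivity)]
        calc _ = Real.exp (-(l ^ 2) * t ^ 2) * (2 * Real.pi) * (‖F (t • (v : E))‖ * t) := by ring
          _ ≤ Real.exp (-(l ^ 2) * t ^ 2) * (2 * Real.pi) * (Vol / 2) :=
            mul_le_mul_of_nonneg_left h3 (by positivity)
          _ = _ := by ring
      simp only [hchar]
      rw [enorm_mul, ← ofReal_norm]
      refine (mul_le_mul_right h1 _).trans ?_
      rw [← mul_assoc, ← ENNReal.ofReal_mul (norm_nonneg _)]
      exact mul_le_mul_left (ENNReal.ofReal_le_ofReal h2) _)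
  rw [hGint] at hD
  refine add_le_add (ENNReal.ofReal_le_ofReal ?_) (hD.trans (mul_le_mul_left
    (ENNReal.ofReal_le_ofReal ?_) _))
  · nlinarith
  · have : 0 ≤ (l ^ d)⁻¹ := by positivity
    nlinarith

/-- In the pullback Euclidean setting, for `p ≥ 1` and `r > 0` there is a
constant `C_{d,p,r}` such that for all `μ, ν` supported in the closed ball `B(o,r)`,
`W_p^p(μ, ν) ≤ C_{d,p,r} · CHSW_p(μ, ν)^{1/(d+1)}`. -/
theorem wassersteinPow_le_chswPullback_rpow
    {d : ℕ} {M : Type*} [MeasurableSpace M]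
    (φ : M ≃ EuclideanSpace ℝ (Fin d)) (hφ : Measurable (φ : M → EuclideanSpace ℝ (Fin d)))
    (o : M) (p : ℝ) (hp : 1 ≤ p) (r : ℝ) (hr : 0 < r) :
    ∃ C : ℝ, 0 < C ∧
      ∀ (μ ν : Measure M), IsProbabilityMeasure μ → IsProbabilityMeasure ν →
        (∀ᵐ x ∂μ, pullbackDist φ x o ≤ r) → (∀ᵐ x ∂ν, pullbackDist φ x o ≤ r) →
        wpPowPullback φ p μ ν ≤
          ENNReal.ofReal C * (chswPullback φ o p μ ν) ^ (1 / ((d : ℝ) + 1)) := by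
  rcases eq_or_ne d 0 with rfl | hd
  · refine ⟨1, one_pos, fun μ ν hμp hνp _ _ => ?_⟩
    have h0 : wpPowPullback φ p μ ν ≤ 0 := by
      refine (iInf₂_le (μ.prod ν) ⟨?_, ?_⟩).trans ?_
      · have h1 : ∀ x y : M, pullbackDist φ x y = 0 := fun x y => by
          rw [pullbackDist, Subsingleton.elim (φ x) (φ y), sub_self, norm_zero]
        simp [h1, Real.zero_rpow (by linarith : p ≠ 0)]
      · rw [Measure.map_fst_prod, measure_univ, one_smul]
      · rw [Measure.map_snd_prod, measure_univ, one_smul]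
    exact h0.trans zero_le
  obtain ⟨C, hC, hdisc⟩ := exists_ofReal_integral_sub_le_sliced hd hp r
  refine ⟨(2 * r) ^ (p - 1) * (2 * C + 1), by positivity, fun μ ν hμp hνp hμ hν => ?_⟩
  set ψ : M → EuclideanSpace ℝ (Fin d) := fun x => φ x - φ o with hψdef
  have hψ : Measurable ψ := hφ.sub_const _
  have hdist : ∀ x y, pullbackDist φ x y = ‖ψ x - ψ y‖ := fun x y => by
    simp [pullbackDist, hψdef]
  set S : ℝ≥0∞ := chswPullback φ o p μ ν with hS
  have hexp : 0 < 1 / ((d : ℝ) + 1) := by positivity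
  have hslice : ∀ (ρ : Measure M) (v : EuclideanSpace ℝ (Fin d)),
      (ρ.map ψ).map (fun x => ⟪x, v⟫) = ρ.map fun x => ⟪φ x - φ o, v⟫ := fun ρ v =>
    Measure.map_map (by fun_prop) hψ
  have hdisc' : ∀ f : EuclideanSpace ℝ (Fin d) → ℝ, LipschitzWith 1 f → ∀ l : ℝ, 0 < l →
      ENNReal.ofReal (∫ x, f (ψ x) ∂μ - ∫ x, f (ψ x) ∂ν) ≤ ENNReal.ofReal (C * l) +
          ENNReal.ofReal (C * (l ^ d)⁻¹) * S := by
    intro f hf l hl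
    have h := hdisc (μ.map ψ) (ν.map ψ) (Measure.isProbabilityMeasure_map hψ.aemeasurable)
      (Measure.isProbabilityMeasure_map hψ.aemeasurable)
      ((ae_map_iff hψ.aemeasurable (measurableSet_le measurable_norm measurable_const)).2 hμ)
      ((ae_map_iff hψ.aemeasurable (measurableSet_le measurable_norm measurable_const)).2 hν)
      f hf l hl
    rw [integral_map hψ.aemeasurable hf.continuous.aestronglyMeasurable,
      integral_map hψ.aemeasurable hf.continuous.aestronglyMeasurable] at h
    simp only [hslice] at h
    exact h
  have hcost : ∀ l : ℝ, 0 < l → S ≤ ENNReal.ofReal (l ^ (d + 1)) →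
      wpPowPullback φ p μ ν ≤ ENNReal.ofReal ((2 * r) ^ (p - 1) * ((2 * C + 1) * l)) := by
    intro l hl hSl
    have hK : 2 * C * l < (2 * C + 1) * l := by linarith
    unfold wpPowPullback
    simp only [hdist]
    refine transportCost_le_of_lipschitz_discrepancy hψ hp hr hμ hν hK fun f hf => ?_
    rw [← ENNReal.ofReal_le_ofReal_iff (by positivity)]
    refine (hdisc' f hf l hl).trans ((add_le_add_right (mul_le_mul_right hSl _) _).trans_eq ?_)
    rw [← ENNReal.ofReal_mul (by positivity), ← ENNReal.ofReal_add (by positivity) (by positivity)]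
    congr 1
    field_simp
    ring
  rcases eq_or_ne S ∞ with hS_top | hS_top
  · rw [hS_top, ENNReal.top_rpow_of_pos hexp, ENNReal.mul_top]
    · exact le_top
    · simp only [ne_eq, ENNReal.ofReal_eq_zero, not_le]
      positivity
  rcases eq_or_ne S 0 with hS0 | hS0
  · rw [hS0, ENNReal.zero_rpow_of_pos hexp, mul_zero]
    refine ge_of_tendsto (x := nhdsWithin (0 : ℝ) (Set.Ioi 0))
      (f := fun l => ENNReal.ofReal ((2 * r) ^ (p - 1) * ((2 * C + 1) * l))) ?_ ?_
    · have hc : Continuous fun l : ℝ =>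
          ENNReal.ofReal ((2 * r) ^ (p - 1) * ((2 * C + 1) * l)) :=
        ENNReal.continuous_ofReal.comp (by fun_prop)
      simpa using (hc.tendsto 0).mono_left nhdsWithin_le_nhds
    · filter_upwards [self_mem_nhdsWithin] with l hl
      exact hcost l hl (hS0 ▸ zero_le)
  · have hs : 0 < S.toReal := ENNReal.toReal_pos hS0 hS_top
    have hl : 0 < S.toReal ^ (1 / ((d : ℝ) + 1)) := Real.rpow_pos_of_pos hs _
    refine (hcost _ hl ?_).trans_eq ?_
    · rw [← Real.rpow_natCast, ← Real.rpow_mul hs.le]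
      push_cast
      rw [one_div_mul_cancel (by positivity), Real.rpow_one, ENNReal.ofReal_toReal hS_top]
    · rw [← mul_assoc, ENNReal.ofReal_mul (by positivity), ← ENNReal.ofReal_rpow_of_pos hs,
        ENNReal.ofReal_toReal hS_top]
end

section
/- In the Lorentz model, let v ∈ ℝ^{d+1} with v_0 = 0 and ‖v‖_2 = 1, and let x ∈ 𝕃^d_K. Then the function t ↦ d_𝕃(γ_v(t), x) attains its minimum over ℝ at a unique point, equal to t* = (1/√(−K)) · arctanh(−(1/√(−K)) · ⟨x, v⟩_𝕃 / ⟨x, x^0⟩_𝕃); in particular the quantity −(1/√(−K)) ⟨x,v⟩_𝕃/⟨x,x^0⟩_𝕃 lies in (−1, 1). -/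
/-- Inverse hyperbolic cosine, `arcosh x = log (x + √(x² - 1))`. -/
noncomputable def arcosh (x : ℝ) : ℝ := Real.log (x + Real.sqrt (x ^ 2 - 1))

/-- Inverse hyperbolic tangent, `artanh x = (1/2) log ((1 + x)/(1 - x))`. -/
noncomputable def artanh (x : ℝ) : ℝ := Real.log ((1 + x) / (1 - x)) / 2

/-- The Minkowski bilinear form `⟨x, y⟩_𝕃 = -x₀y₀ + ∑ᵢ xᵢyᵢ` on `ℝ^{d+1}`. -/
def mink {d : ℕ} (x y : Fin (d + 1) → ℝ) : ℝ :=
  -(x 0 * y 0) + ∑ i : Fin d, x i.succ * y i.succ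

/-- The origin `x⁰ = (1/√(-K), 0, …, 0)` of the Lorentz model `𝕃^d_K`. -/
noncomputable def lorOrigin (d : ℕ) (K : ℝ) : Fin (d + 1) → ℝ :=
  fun i => if i = 0 then 1 / Real.sqrt (-K) else 0

/-- The geodesic distance `d_𝕃(x,y) = arccosh(K⟨x,y⟩_𝕃)/√(-K)` of the Lorentz model. -/
noncomputable def lorDist {d : ℕ} (K : ℝ) (x y : Fin (d + 1) → ℝ) : ℝ :=
  arcosh (K * mink x y) / Real.sqrt (-K)

/-- The geodesic `γ_v(t) = cosh(√(-K) t) x⁰ + sinh(√(-K) t) v/√(-K)` through the origin. -/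
noncomputable def lorGeodesic {d : ℕ} (K : ℝ) (v : Fin (d + 1) → ℝ) (t : ℝ) :
    Fin (d + 1) → ℝ :=
  Real.cosh (Real.sqrt (-K) * t) • lorOrigin d K +
    (Real.sinh (Real.sqrt (-K) * t) / Real.sqrt (-K)) • v

theorem artanh_eq_real_artanh {a : ℝ} (ha : a ∈ Set.Ioo (-1 : ℝ) 1) :
    artanh a = Real.artanh a := by
  rw [Real.artanh_eq_half_log (Set.Ioo_subset_Icc_self ha), artanh]
  ring

theorem arcosh_lt_arcosh_of_pos {y z : ℝ} (hy : 0 < y) (hyz : y < z) :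
    arcosh y < arcosh z :=
  Real.strictMonoOn_arcosh hy (hy.trans hyz) hyz

theorem cosh_sub_mul_sinh {u a : ℝ} (hu : Real.tanh u = a) (w : ℝ) :
    Real.cosh w - a * Real.sinh w = Real.cosh (w - u) / Real.cosh u := by
  rw [← hu, Real.tanh_eq_sinh_div_cosh, Real.cosh_sub]
  field_simp [(Real.cosh_pos u).ne']

theorem mink_lorOrigin {d : ℕ} (K : ℝ) (x : Fin (d + 1) → ℝ) :
    mink x (lorOrigin d K) = -(x 0 / Real.sqrt (-K)) := by
  simp [mink, lorOrigin, div_eq_mul_inv]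

theorem mul_mink_lorGeodesic {d : ℕ} {K : ℝ} (hK : K < 0) {v x : Fin (d + 1) → ℝ}
    (hx0 : x 0 ≠ 0) (t : ℝ) :
    K * mink (lorGeodesic K v t) x =
      Real.sqrt (-K) * x 0 * (Real.cosh (Real.sqrt (-K) * t) -
        mink x v / x 0 * Real.sinh (Real.sqrt (-K) * t)) := by
  have hs : 0 < Real.sqrt (-K) := Real.sqrt_pos.2 (by linarith)
  have hsq : K = -Real.sqrt (-K) ^ 2 := by rw [Real.sq_sqrt (by linarith)]; ring
  have key : mink (lorGeodesic K v t) x =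
      Real.cosh (Real.sqrt (-K) * t) * mink x (lorOrigin d K) +
        Real.sinh (Real.sqrt (-K) * t) / Real.sqrt (-K) * mink x v := by
    simp only [mink, lorGeodesic, Pi.add_apply, Pi.smul_apply, smul_eq_mul, mul_add,
      Finset.mul_sum, add_mul, Finset.sum_add_distrib]
    have h1 : ∀ c : ℝ, ∀ y : Fin (d + 1) → ℝ,
        ∑ i : Fin d, c * y i.succ * x i.succ = ∑ i : Fin d, c * (x i.succ * y i.succ) :=
      fun c y => Finset.sum_congr rfl fun i _ => by ring
    rw [h1, h1]
    ring
  rw [key, mink_lorOrigin]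
  generalize Real.sqrt (-K) = s at *
  rw [hsq]
  field_simp
  ring

theorem mink_sq_lt {d : ℕ} {K : ℝ} (hK : K < 0) {v x : Fin (d + 1) → ℝ}
    (hv0 : v 0 = 0) (hv : Real.sqrt (∑ i, v i ^ 2) = 1) (hx : mink x x = 1 / K) :
    mink x v ^ 2 < x 0 ^ 2 := by
  have hv1 : ∑ i : Fin d, v i.succ ^ 2 = 1 := by
    simpa [Fin.sum_univ_succ, hv0] using Real.sqrt_eq_one.1 hv
  have hcs := Finset.sum_mul_sq_le_sq_mul_sq Finset.univ
    (fun i : Fin d => x i.succ) (fun i => v i.succ)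
  have hneg : 1 / K < 0 := one_div_neg.2 hK
  simp only [mink, hv0, ← pow_two] at hx ⊢
  rw [hv1] at hcs
  simp only [mul_zero, neg_zero, zero_add]
  linarith

/-- In the Lorentz model, for a unit direction `v` with `v₀ = 0` and
`x ∈ 𝕃^d_K`, the map `t ↦ d_𝕃(γ_v(t), x)` attains its minimum at the unique point
`t* = arctanh(-(1/√(-K)) ⟨x,v⟩_𝕃/⟨x,x⁰⟩_𝕃)/√(-K)`; in particular the argument of
`arctanh` lies in `(-1, 1)`. -/
theorem lorentz_geodesic_projection
    {d : ℕ} (K : ℝ) (hK : K < 0) (v : Fin (d + 1) → ℝ)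
    (hv0 : v 0 = 0) (hv : Real.sqrt (∑ i, v i ^ 2) = 1)
    (x : Fin (d + 1) → ℝ) (hx : mink x x = 1 / K) (hx0 : x 0 > 0) :
    -(1 / Real.sqrt (-K)) * (mink x v / mink x (lorOrigin d K)) ∈ Set.Ioo (-1 : ℝ) 1 ∧
      ∀ t : ℝ,
        t ≠ (1 / Real.sqrt (-K)) *
            artanh (-(1 / Real.sqrt (-K)) * (mink x v / mink x (lorOrigin d K))) →
          lorDist K
              (lorGeodesic K v
                ((1 / Real.sqrt (-K)) *
                  artanh (-(1 / Real.sqrt (-K)) * (mink x v / mink x (lorOrigin d K))))) x <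
            lorDist K (lorGeodesic K v t) x := by
  have hs : 0 < Real.sqrt (-K) := Real.sqrt_pos.2 (by linarith)
  have harg : -(1 / Real.sqrt (-K)) * (mink x v / mink x (lorOrigin d K)) =
      mink x v / x 0 := by
    rw [mink_lorOrigin]
    field_simp
  rw [harg]
  have ha : mink x v / x 0 ∈ Set.Ioo (-1 : ℝ) 1 := by
    have h := abs_lt_of_sq_lt_sq (mink_sq_lt hK hv0 hv hx) hx0.le
    rw [abs_lt] at h
    constructor
    · rw [lt_div_iff₀ hx0]; linarith
    · rw [div_lt_one hx0]; exact h.2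
  refine ⟨ha, fun t ht => ?_⟩
  rw [artanh_eq_real_artanh ha] at ht ⊢
  have hu := Real.tanh_artanh ha
  set u := Real.artanh (mink x v / x 0)
  have hcu := Real.cosh_pos u
  have hne : Real.sqrt (-K) * t - u ≠ 0 := fun h => ht <| by
    field_simp
    linarith
  have hmul : Real.sqrt (-K) * (1 / Real.sqrt (-K) * u) = u := by field_simp
  unfold lorDist
  rw [mul_mink_lorGeodesic hK hx0.ne', mul_mink_lorGeodesic hK hx0.ne',
    cosh_sub_mul_sinh hu, cosh_sub_mul_sinh hu, hmul, sub_self, Real.cosh_zero]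
  refine div_lt_div_of_pos_right (arcosh_lt_arcosh_of_pos (by positivity) ?_) hs
  have hlt := Real.one_lt_cosh.2 hne
  gcongr
end

section
/- In the Lorentz model, let v ∈ ℝ^{d+1} with v_0 = 0 and ‖v‖_2 = 1, and let x ∈ 𝕃^d_K. Then the Busemann limit along the geodesic γ_v exists and equals lim_{t→∞} (d_𝕃(γ_v(t), x) − t) = (1/√(−K)) · log(−√(−K) · ⟨x, √(−K) x^0 + v⟩_𝕃). -/
/-- For `b < a`, `arcosh (a cosh u - b sinh u) = u + log (a - b) + o(1)` as `u → ∞`. -/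
theorem tendsto_arcosh_cosh_sub_sinh {a b : ℝ} (hab : b < a) :
    Filter.Tendsto (fun u : ℝ => arcosh (a * Real.cosh u - b * Real.sinh u) - u) Filter.atTop
      (nhds (Real.log (a - b))) := by
  set g : ℝ → ℝ := fun w =>
    ((a - b) / 2 + (a + b) / 2 * w ^ 2) +
      Real.sqrt (((a - b) / 2 + (a + b) / 2 * w ^ 2) ^ 2 - w ^ 2) with hg
  have hg0 : g 0 = a - b := by
    have h : Real.sqrt (((a - b) / 2) ^ 2) = (a - b) / 2 := Real.sqrt_sq (by linarith)
    simp only [hg, ne_eq, OfNat.ofNat_ne_zero, not_false_eq_true, zero_pow, mul_zero, add_zero,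
      sub_zero, h]
    ring
  have hlim : Filter.Tendsto (fun u : ℝ => g (Real.exp (-u))) Filter.atTop (nhds (a - b)) := by
    have hcont : Continuous g := by fun_prop
    rw [← hg0]
    exact (hcont.tendsto 0).comp Real.tendsto_exp_neg_atTop_nhds_zero
  refine (hlim.log (by linarith)).congr' ?_
  filter_upwards [hlim.eventually (lt_mem_nhds (sub_pos.2 hab))] with u hu
  have hmul : Real.exp u * Real.exp (-u) = 1 := by rw [← Real.exp_add]; simp
  have hscale : a * Real.cosh u - b * Real.sinh u =
      Real.exp u * ((a - b) / 2 + (a + b) / 2 * Real.exp (-u) ^ 2) := by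
    rw [Real.cosh_eq, Real.sinh_eq]
    linear_combination (-(a + b) / 2 * Real.exp (-u)) * hmul
  have hsqrt : (a * Real.cosh u - b * Real.sinh u) ^ 2 - 1 = Real.exp u ^ 2 *
      (((a - b) / 2 + (a + b) / 2 * Real.exp (-u) ^ 2) ^ 2 - Real.exp (-u) ^ 2) := by
    rw [hscale]
    linear_combination (Real.exp u * Real.exp (-u) + 1) * hmul
  have hfactor : (a * Real.cosh u - b * Real.sinh u) +
      Real.sqrt ((a * Real.cosh u - b * Real.sinh u) ^ 2 - 1) =
        Real.exp u * g (Real.exp (-u)) := by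
    rw [hsqrt, Real.sqrt_mul (sq_nonneg _), Real.sqrt_sq (Real.exp_pos u).le, hscale, hg]
    ring
  rw [arcosh, hfactor, Real.log_mul (Real.exp_pos u).ne' hu.ne', Real.log_exp]
  ring

/-- The pairing of a point of the hyperboloid with a unit spatial vector is less than its
time coordinate. -/
theorem sum_mul_lt_of_mink_self_neg {d : ℕ} {x v : Fin (d + 1) → ℝ}
    (hx : mink x x < 0) (hx0 : 0 < x 0) (hv : ∑ i : Fin d, v i.succ ^ 2 = 1) :
    ∑ i : Fin d, x i.succ * v i.succ < x 0 := by
  have hcs := Finset.sum_mul_sq_le_sq_mul_sq Finset.univ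
    (fun i : Fin d => x i.succ) (fun i => v i.succ)
  rw [hv, mul_one] at hcs
  simp only [mink, ← sq] at hx
  exact lt_of_pow_lt_pow_left₀ 2 hx0.le (by linarith)

/-- In the Lorentz model, for a unit direction `v` with `v₀ = 0` and
`x ∈ 𝕃^d_K`, the Busemann limit along `γ_v` exists and equals
`log(-√(-K) ⟨x, √(-K) x⁰ + v⟩_𝕃)/√(-K)`. -/
theorem lorentz_busemann
    {d : ℕ} (K : ℝ) (hK : K < 0) (v : Fin (d + 1) → ℝ)
    (hv0 : v 0 = 0) (hv : Real.sqrt (∑ i, v i ^ 2) = 1)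
    (x : Fin (d + 1) → ℝ) (hx : mink x x = 1 / K) (hx0 : x 0 > 0) :
    Filter.Tendsto (fun t : ℝ => lorDist K (lorGeodesic K v t) x - t) Filter.atTop
      (nhds ((1 / Real.sqrt (-K)) *
        Real.log (-Real.sqrt (-K) * mink x (Real.sqrt (-K) • lorOrigin d K + v)))) := by
  have hs : 0 < Real.sqrt (-K) := Real.sqrt_pos.2 (by linarith)
  have hKs : K = -Real.sqrt (-K) ^ 2 := by rw [Real.sq_sqrt (by linarith)]; ring
  have hv1 : ∑ i : Fin d, v i.succ ^ 2 = 1 := by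
    rw [Real.sqrt_eq_one, Fin.sum_univ_succ, hv0] at hv
    simpa using hv
  have hlt := sum_mul_lt_of_mink_self_neg (hx.trans_lt (one_div_neg.2 hK)) hx0 hv1
  set s := Real.sqrt (-K) with hs_def
  set S := ∑ i : Fin d, x i.succ * v i.succ with hS
  have hform (t : ℝ) : K * mink (lorGeodesic K v t) x =
      s * x 0 * Real.cosh (s * t) - s * S * Real.sinh (s * t) := by
    have hsum : ∑ i : Fin d, Real.sinh (s * t) / s * v i.succ * x i.succ =
        Real.sinh (s * t) / s * S := by
      rw [hS, Finset.mul_sum]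
      exact Finset.sum_congr rfl fun i _ => by ring
    simp only [mink, lorGeodesic, lorOrigin, ← hs_def, Pi.add_apply, Pi.smul_apply, smul_eq_mul,
      hv0, if_true, Fin.succ_ne_zero, if_false, mul_zero, add_zero, zero_add, hsum]
    rw [hKs]
    field_simp
    ring
  have hlimit : -s * mink x (s • lorOrigin d K + v) = s * x 0 - s * S := by
    simp only [mink, lorOrigin, ← hs_def, Pi.add_apply, Pi.smul_apply, smul_eq_mul,
      hv0, if_true, Fin.succ_ne_zero, if_false, mul_zero, add_zero, zero_add, ← hS]
    field_simp
    ring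
  rw [hlimit]
  have hmain := ((tendsto_arcosh_cosh_sub_sinh (mul_lt_mul_of_pos_left hlt hs)).comp
    (Filter.tendsto_id.const_mul_atTop hs)).const_mul (1 / s)
  refine hmain.congr fun t => ?_
  simp only [Function.comp_apply, id_eq, lorDist, hform, ← hs_def]
  field_simp
end

section
/- In the Poincaré ball, let ṽ ∈ S^{d−1} be an ideal point and x ∈ 𝔹^d_K. Define s(x) = (1 − K‖x‖_2^2 − √((1 − K‖x‖_2^2)^2 + 4K⟨x, ṽ⟩^2))/(−2K⟨x, ṽ⟩) if ⟨x, ṽ⟩ ≠ 0, and s(x) = 0 if ⟨x, ṽ⟩ = 0. Then the function t ↦ d_𝔹(γ_ṽ(t), x) attains its minimum over ℝ at t* = (2/√(−K)) · arctanh(√(−K) · s(x)). -/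
open scoped RealInnerProductSpace

/-- The geodesic distance of the Poincaré ball `𝔹^d_K`,
`d_𝔹(x,y) = arccosh(1 - 2K‖x-y‖²/((1+K‖x‖²)(1+K‖y‖²)))/√(-K)`. -/
noncomputable def pbDist {d : ℕ} (K : ℝ) (x y : EuclideanSpace ℝ (Fin d)) : ℝ :=
  arcosh (1 - 2 * K * ‖x - y‖ ^ 2 / ((1 + K * ‖x‖ ^ 2) * (1 + K * ‖y‖ ^ 2))) / Real.sqrt (-K)

/-- The geodesic `γ_ṽ(t) = tanh(√(-K) t/2) ṽ/√(-K)` through `0` towards the ideal point `ṽ`. -/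
noncomputable def pbGeodesic {d : ℕ} (K : ℝ) (v : EuclideanSpace ℝ (Fin d)) (t : ℝ) :
    EuclideanSpace ℝ (Fin d) :=
  (Real.tanh (Real.sqrt (-K) * t / 2) / Real.sqrt (-K)) • v

/-- The auxiliary quantity `s(x)` for the geodesic projection on the Poincaré ball. -/
noncomputable def pbProjAux {d : ℕ} (K : ℝ) (v x : EuclideanSpace ℝ (Fin d)) : ℝ :=
  if ⟪x, v⟫ = 0 then 0
  else (1 - K * ‖x‖ ^ 2 -
      Real.sqrt ((1 - K * ‖x‖ ^ 2) ^ 2 + 4 * K * ⟪x, v⟫ ^ 2)) / (-2 * K * ⟪x, v⟫)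

/-- `arcosh` agrees with Mathlib's `Real.arcosh`. -/
lemma arcosh_eq_real_arcosh (x : ℝ) : arcosh x = Real.arcosh x := rfl

/-- On `(-1, 1)`, `artanh` is a right inverse of `tanh`. -/
lemma tanh_artanh_of_mem {x : ℝ} (hx : x ∈ Set.Ioo (-1) 1) : Real.tanh (artanh x) = x := by
  have h : artanh x = Real.artanh x := by
    rw [Real.artanh_eq_half_log (Set.Ioo_subset_Icc_self hx), artanh]
    ring
  rw [h, Real.tanh_artanh hx]

/-- The smaller root of `q S² - A S + q` lies in `(-1, 1)`. For `q = 0` the quotient is `0`. -/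
lemma smaller_root_spec {A q : ℝ} (h : 2 * |q| < A) :
    (A - Real.sqrt (A ^ 2 - 4 * q ^ 2)) / (2 * q) ∈ Set.Ioo (-1) 1 ∧
      A * ((A - Real.sqrt (A ^ 2 - 4 * q ^ 2)) / (2 * q)) =
        q * (1 + ((A - Real.sqrt (A ^ 2 - 4 * q ^ 2)) / (2 * q)) ^ 2) := by
  rcases eq_or_ne q 0 with rfl | hq
  · simp
  have hq' : 0 < |q| := abs_pos.mpr hq
  have hdisc : 0 ≤ A ^ 2 - 4 * q ^ 2 := by nlinarith [sq_abs q]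
  set r := Real.sqrt (A ^ 2 - 4 * q ^ 2)
  have hr0 : 0 ≤ r := Real.sqrt_nonneg _
  have hr2 : r ^ 2 = A ^ 2 - 4 * q ^ 2 := Real.sq_sqrt hdisc
  have hrA : r ≤ A := by nlinarith [sq_nonneg q]
  refine ⟨abs_lt.mp ?_, ?_⟩
  · rw [abs_div, abs_mul, abs_two, div_lt_one (by positivity), abs_of_nonneg (by linarith)]
    nlinarith [sq_abs q]
  · field_simp
    linear_combination (-1) * hr2

/-- A point `S ∈ (-1, 1)` with `A S = q (1 + S²)` minimises `(A - 2 q T) / (1 - T²)`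
over `T ∈ (-1, 1)`. -/
lemma quotient_le_of_critical {A q S T : ℝ} (hA : 0 ≤ A) (hS : S ^ 2 < 1) (hT : T ^ 2 < 1)
    (h : A * S = q * (1 + S ^ 2)) :
    (A - 2 * q * S) / (1 - S ^ 2) ≤ (A - 2 * q * T) / (1 - T ^ 2) := by
  have hS' : 0 < 1 + S ^ 2 := by positivity
  obtain rfl : q = A * S / (1 + S ^ 2) := by rw [h]; field_simp
  have hS1 : (A - 2 * (A * S / (1 + S ^ 2)) * S) / (1 - S ^ 2) = A / (1 + S ^ 2) := by
    have : 1 - S ^ 2 ≠ 0 := by linarith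
    field_simp
    ring
  have hT1 : A - 2 * (A * S / (1 + S ^ 2)) * T =
      A / (1 + S ^ 2) * (1 + S ^ 2 - 2 * S * T) := by
    field_simp
  rw [hS1, hT1, le_div_iff₀ (by linarith)]
  exact mul_le_mul_of_nonneg_left (by nlinarith [sq_nonneg (S - T)]) (by positivity)

/-- The distance from `x` to a point of the geodesic through `0` towards `v`, as a function of
`T = tanh (√(-K) t / 2)`. -/
lemma pbDist_pbGeodesic {d : ℕ} {K : ℝ} (hK : K < 0) {v : EuclideanSpace ℝ (Fin d)} (hv : ‖v‖ = 1)
    (x : EuclideanSpace ℝ (Fin d)) (t : ℝ) :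
    pbDist K (pbGeodesic K v t) x =
      Real.arcosh (1 + 2 / (1 + K * ‖x‖ ^ 2) *
        ((1 - K * ‖x‖ ^ 2 - 2 * (Real.sqrt (-K) * ⟪x, v⟫) * Real.tanh (Real.sqrt (-K) * t / 2)) /
          (1 - Real.tanh (Real.sqrt (-K) * t / 2) ^ 2) - 1)) / Real.sqrt (-K) := by
  rw [pbDist, pbGeodesic, arcosh_eq_real_arcosh]
  have hT := Real.tanh_sq_lt_one (Real.sqrt (-K) * t / 2)
  set T := Real.tanh (Real.sqrt (-K) * t / 2)
  have hc : 0 < Real.sqrt (-K) := Real.sqrt_pos.mpr (by linarith)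
  have hc2 : Real.sqrt (-K) ^ 2 = -K := Real.sq_sqrt (by linarith)
  set c := Real.sqrt (-K)
  clear_value T c
  obtain rfl : K = -c ^ 2 := by linarith
  rw [norm_sub_sq_real, real_inner_smul_left, norm_smul, hv, mul_one, real_inner_comm,
    Real.norm_eq_abs, sq_abs]
  have hT' : 1 - T ^ 2 ≠ 0 := by linarith
  have hTc : 1 + -c ^ 2 * (T / c) ^ 2 = 1 - T ^ 2 := by field_simp; ring
  rw [hTc]
  congr 3
  rw [sub_eq_add_neg, add_right_inj, div_sub_one hT', div_mul_div_comm, ← neg_div,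
    mul_comm (1 - T ^ 2)]
  congr 1
  field_simp
  ring

/-- In the Poincaré ball, for an ideal point `ṽ ∈ S^{d-1}` and
`x ∈ 𝔹^d_K`, the map `t ↦ d_𝔹(γ_ṽ(t), x)` attains its minimum over `ℝ` at
`t* = (2/√(-K)) arctanh(√(-K) s(x))`. -/
theorem poincare_geodesic_projection
    {d : ℕ} (K : ℝ) (hK : K < 0) (v : EuclideanSpace ℝ (Fin d)) (hv : ‖v‖ = 1)
    (x : EuclideanSpace ℝ (Fin d)) (hx : ‖x‖ ^ 2 < -(1 / K)) :
    ∀ t : ℝ,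
      pbDist K (pbGeodesic K v ((2 / Real.sqrt (-K)) * artanh (Real.sqrt (-K) * pbProjAux K v x))) x ≤
        pbDist K (pbGeodesic K v t) x := by
  intro t
  have hc : 0 < Real.sqrt (-K) := Real.sqrt_pos.mpr (by linarith)
  have hc2 : Real.sqrt (-K) ^ 2 = -K := Real.sq_sqrt (by linarith)
  have hD : 0 < 1 + K * ‖x‖ ^ 2 := by
    rw [← neg_div, lt_div_iff_of_neg hK] at hx
    linarith
  have hp : ⟪x, v⟫ ^ 2 ≤ ‖x‖ ^ 2 := by
    rw [← sq_abs ⟪x, v⟫]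
    gcongr
    simpa [hv] using abs_real_inner_le_norm x v
  have hq : 2 * |Real.sqrt (-K) * ⟪x, v⟫| < 1 - K * ‖x‖ ^ 2 := by
    have hq2 : |Real.sqrt (-K) * ⟪x, v⟫| ^ 2 ≤ -K * ‖x‖ ^ 2 := by
      rw [sq_abs, mul_pow, hc2]
      exact mul_le_mul_of_nonneg_left hp (by linarith)
    have hq1 : |Real.sqrt (-K) * ⟪x, v⟫| < 1 := (sq_lt_one_iff₀ (abs_nonneg _)).mp (by linarith)
    nlinarith
  have hs : Real.sqrt (-K) * pbProjAux K v x =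
      (1 - K * ‖x‖ ^ 2 - Real.sqrt ((1 - K * ‖x‖ ^ 2) ^ 2 -
        4 * (Real.sqrt (-K) * ⟪x, v⟫) ^ 2)) / (2 * (Real.sqrt (-K) * ⟪x, v⟫)) := by
    rw [pbProjAux, mul_pow, hc2]
    split_ifs with h
    · simp [h]
    · rw [show -2 * K * ⟪x, v⟫ = 2 * Real.sqrt (-K) ^ 2 * ⟪x, v⟫ by rw [hc2]; ring,
        show (1 - K * ‖x‖ ^ 2) ^ 2 - 4 * (-K * ⟪x, v⟫ ^ 2) =
          (1 - K * ‖x‖ ^ 2) ^ 2 + 4 * K * ⟪x, v⟫ ^ 2 by ring]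
      field_simp
  obtain ⟨hmem, hcrit⟩ := smaller_root_spec hq
  rw [← hs] at hmem hcrit
  have htanh : Real.tanh (Real.sqrt (-K) *
      (2 / Real.sqrt (-K) * artanh (Real.sqrt (-K) * pbProjAux K v x)) / 2) =
      Real.sqrt (-K) * pbProjAux K v x := by
    rw [← tanh_artanh_of_mem hmem]
    congr 1
    rw [tanh_artanh_of_mem hmem]
    field_simp
  have hone_le : ∀ T : ℝ, T ^ 2 < 1 →
      1 ≤ (1 - K * ‖x‖ ^ 2 - 2 * (Real.sqrt (-K) * ⟪x, v⟫) * T) / (1 - T ^ 2) := by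
    intro T hT
    rw [one_le_div (by linarith)]
    nlinarith [sq_nonneg (T - Real.sqrt (-K) * ⟪x, v⟫)]
  have hS := (sq_lt_one_iff_abs_lt_one _).mpr (abs_lt.mpr hmem)
  have hT := Real.tanh_sq_lt_one (Real.sqrt (-K) * t / 2)
  have hpos : ∀ y : ℝ, 1 ≤ y → 0 < 1 + 2 / (1 + K * ‖x‖ ^ 2) * (y - 1) := fun y hy ↦
    add_pos_of_pos_of_nonneg one_pos (mul_nonneg (by positivity) (by linarith))
  rw [pbDist_pbGeodesic hK hv, pbDist_pbGeodesic hK hv, htanh]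
  refine div_le_div_of_nonneg_right ?_ hc.le
  rw [Real.arcosh_le_arcosh (hpos _ (hone_le _ hS)) (hpos _ (hone_le _ hT))]
  have hA : 0 ≤ 1 - K * ‖x‖ ^ 2 := by linarith [abs_nonneg (Real.sqrt (-K) * ⟪x, v⟫)]
  have hmin := quotient_le_of_critical hA hS hT hcrit
  have hfac : 0 ≤ 2 / (1 + K * ‖x‖ ^ 2) := by positivity
  linarith [mul_le_mul_of_nonneg_left (sub_le_sub_right hmin 1) hfac]
end

section
/- Let (M_1, d_1), …, (M_n, d_n) be metric spaces and for each i let γ_i : ℝ → M_i be a geodesic line, i.e. d_i(γ_i(s), γ_i(t)) = |s − t| for all s, t ∈ ℝ. Let λ_1, …, λ_n ≥ 0 with Σ_{i=1}^n λ_i^2 = 1. Equip the product M = M_1 × ⋯ × M_n with the distance d(x, y)^2 = Σ_{i=1}^n d_i(x_i, y_i)^2, and define γ(t) = (γ_1(λ_1 t), …, γ_n(λ_n t)), which is a geodesic line in M. Assume that for each i and each x_i ∈ M_i the Busemann limit B^{γ_i}(x_i) = lim_{s→∞} (d_i(x_i, γ_i(s)) − s) exists. Then for every x = (x_1, …, x_n)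 ∈ M, the limit B^γ(x) = lim_{t→∞} (d(x, γ(t)) − t) exists and B^γ(x) = Σ_{i=1}^n λ_i B^{γ_i}(x_i). -/
open Filter Topology in
/-- If `(Q t - t ^ 2) / t` tends to `2 * a` and `Q` is nonnegative, then `√(Q t) - t` tends
to `a` as `t → ∞`. -/
theorem tendsto_sqrt_sub_self_atTop {Q : ℝ → ℝ} {a : ℝ} (hQ : ∀ t, 0 ≤ Q t)
    (h : Tendsto (fun t => (Q t - t ^ 2) / t) atTop (𝓝 (2 * a))) :
    Tendsto (fun t => Real.sqrt (Q t) - t) atTop (𝓝 a) := by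
  have h1 : Tendsto (fun t => 1 + (Q t - t ^ 2) / t * t⁻¹) atTop (𝓝 1) := by
    simpa using (h.mul tendsto_inv_atTop_zero).const_add 1
  have h2 : Tendsto (fun t => Real.sqrt (1 + (Q t - t ^ 2) / t * t⁻¹) + 1) atTop (𝓝 2) := by
    have := h1.sqrt.add_const 1
    rwa [Real.sqrt_one, one_add_one_eq_two] at this
  have h3 := h.div h2 two_ne_zero
  rw [mul_div_cancel_left₀ a two_ne_zero] at h3
  refine h3.congr' ?_
  filter_upwards [eventually_gt_atTop 0] with t ht
  have e : 1 + (Q t - t ^ 2) / t * t⁻¹ = Q t / t ^ 2 := by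
    field_simp
    ring
  have e2 : Real.sqrt (Q t / t ^ 2) = Real.sqrt (Q t) / t := by
    rw [Real.sqrt_div (hQ t), Real.sqrt_sq ht.le]
  have hs := Real.sqrt_nonneg (Q t)
  have hp : 0 < Real.sqrt (Q t) + t := by positivity
  simp only [Pi.div_apply, e, e2]
  rw [div_add_one ht.ne', div_div_div_cancel_right₀ ht.ne', div_eq_iff hp.ne']
  linear_combination -Real.sq_sqrt (hQ t)


/-- Busemann functions on a product of metric spaces: if `γᵢ` are geodesic
lines in metric spaces `Mᵢ`, `λᵢ ≥ 0` with `∑ λᵢ² = 1`, and the Busemann limits `B^{γᵢ}` exist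
on each factor, then `γ(t) = (γ₁(λ₁ t), …, γ_n(λ_n t))` is a geodesic line for the product
distance `d(x,y)² = ∑ dᵢ(xᵢ,yᵢ)²`, its Busemann limit exists at every point, and
`B^γ(x) = ∑ᵢ λᵢ B^{γᵢ}(xᵢ)`. -/
theorem busemann_product
    {n : ℕ} (M : Fin n → Type*) [∀ i, MetricSpace (M i)]
    (γ : ∀ i, ℝ → M i) (hγ : ∀ i, ∀ s t : ℝ, dist (γ i s) (γ i t) = |s - t|)
    (l : Fin n → ℝ) (hl : ∀ i, 0 ≤ l i) (hl2 : ∑ i, l i ^ 2 = 1)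
    (B : ∀ i, M i → ℝ)
    (hB : ∀ i (xi : M i),
      Filter.Tendsto (fun s : ℝ => dist xi (γ i s) - s) Filter.atTop (nhds (B i xi))) :
    (∀ s t : ℝ,
        Real.sqrt (∑ i, dist (γ i (l i * s)) (γ i (l i * t)) ^ 2) = |s - t|) ∧
      ∀ x : ∀ i, M i,
        Filter.Tendsto (fun t : ℝ => Real.sqrt (∑ i, dist (x i) (γ i (l i * t)) ^ 2) - t)
          Filter.atTop (nhds (∑ i, l i * B i (x i))) := by
  refine ⟨fun s t => ?_, fun x => ?_⟩
  · have e : ∑ i, dist (γ i (l i * s)) (γ i (l i * t)) ^ 2 = (s - t) ^ 2 := by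
      simp_rw [hγ, sq_abs, ← mul_sub, mul_pow]
      rw [← Finset.sum_mul, hl2, one_mul]
    rw [e, Real.sqrt_sq_eq_abs]
  · set g : Fin n → ℝ → ℝ := fun i t => dist (x i) (γ i (l i * t)) - l i * t with hg
    have hconv : ∀ i, ∃ c, Filter.Tendsto (g i) Filter.atTop (nhds c) ∧
        l i * c = l i * B i (x i) := by
      intro i
      rcases (hl i).eq_or_lt with h0 | hpos
      · exact ⟨dist (x i) (γ i 0), by simp [hg, ← h0], by simp [← h0]⟩
      · exact ⟨B i (x i), (hB i (x i)).comp (Filter.tendsto_id.const_mul_atTop hpos), rfl⟩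
    choose c hc hlc using hconv
    apply tendsto_sqrt_sub_self_atTop (fun t => Finset.sum_nonneg fun i _ => sq_nonneg _)
    have hlin : Filter.Tendsto (fun t => ∑ i, l i * g i t) Filter.atTop
        (nhds (∑ i, l i * B i (x i))) := by
      simp_rw [← hlc]
      exact tendsto_finsetSum _ fun i _ => (hc i).const_mul (l i)
    have hsq : Filter.Tendsto (fun t => ∑ i, g i t ^ 2) Filter.atTop (nhds (∑ i, c i ^ 2)) :=
      tendsto_finsetSum _ fun i _ => (hc i).pow 2
    have hsum := (hlin.const_mul 2).add (hsq.mul tendsto_inv_atTop_zero)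
    rw [mul_zero, add_zero] at hsum
    refine hsum.congr' ?_
    filter_upwards [Filter.eventually_gt_atTop 0] with t ht
    have e : ∑ i, dist (x i) (γ i (l i * t)) ^ 2 =
        t ^ 2 + 2 * t * ∑ i, l i * g i t + ∑ i, g i t ^ 2 := by
      rw [← one_mul (t ^ 2), ← hl2, Finset.sum_mul, Finset.mul_sum, ← Finset.sum_add_distrib,
        ← Finset.sum_add_distrib]
      refine Finset.sum_congr rfl fun i _ => ?_
      simp only [hg]
      ring
    rw [e]
    field_simp
    ring
end
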